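/- arXiv:2510.02111 — 9 statements merged into one kernel-verified Lean document; each statement's English description precedes it below -/
import Mathlib

section
/- Let S = (x_0, x_1, …) be an equidistributed sequence in base b = (b_1,…,b_d) and let P_n = {x_0,…,x_{n−1}} be its first n points (n ≥ 1). Then for every nonempty u ⊆ {1,…,d}, every v ⊆ u and every k = (k_j)_{j∈u} ∈ ℕ_0^{|u|}, the pair-counting quantity satisfies C_{u,v,k}(P_n) = n + (2n − m_{u,v,k})·⌊n/m_{u,v,k}⌋ − m_{u,v,k}·⌊n/m_{u,v,k}⌋². -/
open Finset MeasureTheory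

noncomputable section


/-- `S` is an equidistributed sequence in base `b`: every point lies in `[0,1)^d` and,
for all `r` and resolutions `k`, every elementary `k`-interval in base `b` contains
exactly one of the points `x_{rB}, …, x_{(r+1)B-1}` where `B = ∏ j, b j ^ k j`. -/
def IsEquidistributed {d : ℕ} (b : Fin d → ℕ) (S : ℕ → Fin d → ℝ) : Prop :=
  (∀ i j, S i j ∈ Set.Ico (0 : ℝ) 1) ∧
  ∀ (r : ℕ) (k : Fin d → ℕ) (a : Fin d → ℤ),
    (∀ j, 0 ≤ a j ∧ a j < (b j : ℤ) ^ k j) →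
    ∃! i, i ∈ Finset.Ico (r * ∏ j, b j ^ k j) ((r + 1) * ∏ j, b j ^ k j) ∧
      ∀ j, ⌊(b j : ℝ) ^ k j * S i j⌋ = a j

/-- `m_{u,v,k} = ∏_{j∈v} b_j^{k_j+1} ∏_{j∈u∖v} b_j^{k_j}`. -/
def mq {d : ℕ} (b : Fin d → ℕ) (u v : Finset (Fin d)) (k : Fin d → ℕ) : ℕ :=
  (∏ j ∈ v, b j ^ (k j + 1)) * ∏ j ∈ u \ v, b j ^ k j

/-- `C_{u,v,k}(P_n)`: number of ordered pairs of the first `n` points of `S` lying in the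
same elementary interval of resolution `k_j + χ(j∈v)` in coordinate `j ∈ u`. -/
def Cq {d : ℕ} (b : Fin d → ℕ) (S : ℕ → Fin d → ℝ) (u v : Finset (Fin d))
    (k : Fin d → ℕ) (n : ℕ) : ℕ :=
  ∑ i ∈ Finset.range n, ∑ i' ∈ Finset.range n,
    if ∀ j ∈ u, ⌊(b j : ℝ) ^ (k j + if j ∈ v then 1 else 0) * S i j⌋
        = ⌊(b j : ℝ) ^ (k j + if j ∈ v then 1 else 0) * S i' j⌋ then 1 else 0

/-- The gain coefficient `G_{u,k}(P_n)` of the first `n` points of `S` in base `b`. -/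
def gain {d : ℕ} (b : Fin d → ℕ) (S : ℕ → Fin d → ℝ) (u : Finset (Fin d))
    (k : Fin d → ℕ) (n : ℕ) : ℝ :=
  (∏ j ∈ u, ((b j : ℝ) - 1)⁻¹) * (n : ℝ)⁻¹ *
    ∑ i ∈ Finset.range n, ∑ i' ∈ Finset.range n,
      ∏ j ∈ u,
        ((b j : ℝ) *
            (if ⌊(b j : ℝ) ^ (k j + 1) * S i j⌋ = ⌊(b j : ℝ) ^ (k j + 1) * S i' j⌋
              then 1 else 0) -
          (if ⌊(b j : ℝ) ^ k j * S i j⌋ = ⌊(b j : ℝ) ^ k j * S i' j⌋ then 1 else 0))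

/-- If every window `[r * m, (r + 1) * m)` contains exactly one index satisfying `p`, then
the first `q` windows contain exactly `q` such indices. -/
theorem sum_indicator_Ico_mul (p : ℕ → Prop) [DecidablePred p] (m : ℕ)
    (h : ∀ r, ∃! i, i ∈ Finset.Ico (r * m) ((r + 1) * m) ∧ p i) (q : ℕ) :
    ∑ i ∈ Finset.Ico 0 (q * m), (if p i then 1 else 0) = q := by
  induction q with
  | zero => simp
  | succ q ih =>
    rw [← Finset.sum_Ico_consecutive _ (Nat.zero_le (q * m))
      (Nat.mul_le_mul_right m (Nat.le_succ q)), ih]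
    obtain ⟨i, hi, huniq⟩ := h q
    rw [Finset.sum_eq_single_of_mem i hi.1, if_pos hi.2]
    intro j hj hne
    exact if_neg fun hp => hne (huniq j ⟨hj, hp⟩)

/-- Pair count for a labelling `f` of `ℕ` in which every label occurs exactly once in each
window `[r * m, (r + 1) * m)`. -/
theorem sum_pair_indicator_eq {α : Type*} [DecidableEq α] (f : ℕ → α) (m : ℕ) (hm : 0 < m)
    (h : ∀ r i, ∃! i', i' ∈ Finset.Ico (r * m) ((r + 1) * m) ∧ f i' = f i) (n : ℕ) :
    ∑ i ∈ Finset.range n, ∑ i' ∈ Finset.range n, (if f i' = f i then 1 else 0)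
      = n * (n / m) + (n % m) * (n / m + 1) := by
  have hqn : n / m * m ≤ n := Nat.div_mul_le_self n m
  have hnq : n < (n / m + 1) * m := by
    rw [mul_comm]; exact Nat.lt_mul_div_succ n hm
  have split : ∀ i, ∑ i' ∈ Finset.range n, (if f i' = f i then 1 else 0)
      = n / m + ∑ i' ∈ Finset.Ico (n / m * m) n, (if f i' = f i then 1 else 0) := by
    intro i
    rw [Finset.range_eq_Ico, ← Finset.sum_Ico_consecutive _ (Nat.zero_le (n / m * m)) hqn,
      sum_indicator_Ico_mul (fun i' => f i' = f i) m (fun r => h r i)]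
  have last : ∀ i ∈ Finset.Ico (n / m * m) n,
      ∑ i' ∈ Finset.range n, (if f i = f i' then 1 else 0) = n / m + 1 := by
    intro i hi
    rw [Finset.sum_congr rfl fun i' _ => if_congr (eq_comm (a := f i)) rfl rfl]
    have mem : ∀ j ∈ Finset.Ico (n / m * m) n,
        j ∈ Finset.Ico (n / m * m) ((n / m + 1) * m) := fun j hj =>
      Finset.Ico_subset_Ico_right hnq.le hj
    rw [split, Finset.sum_eq_single_of_mem i hi, if_pos rfl]
    intro j hj hne
    exact if_neg fun hp => hne ((h (n / m) i).unique ⟨mem j hj, hp⟩ ⟨mem i hi, rfl⟩)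
  have card_last : n - n / m * m = n % m := by
    have := Nat.div_add_mod' n m
    omega
  rw [Finset.sum_congr rfl fun i _ => split i, Finset.sum_add_distrib, Finset.sum_comm,
    Finset.sum_congr rfl last]
  simp [card_last]

/-- The resolution `k_j + χ(j ∈ v)` for `j ∈ u`, extended by `0` outside `u`. -/
def resolution {d : ℕ} (u v : Finset (Fin d)) (k : Fin d → ℕ) (j : Fin d) : ℕ :=
  if j ∈ u then k j + if j ∈ v then 1 else 0 else 0

theorem prod_pow_resolution {d : ℕ} (b : Fin d → ℕ) {u v : Finset (Fin d)} (hv : v ⊆ u)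
    (k : Fin d → ℕ) : ∏ j, b j ^ resolution u v k j = mq b u v k := by
  have hu : ∏ j, b j ^ resolution u v k j = ∏ j ∈ u, b j ^ resolution u v k j :=
    (Finset.prod_subset (Finset.subset_univ u) fun j _ hj => by simp [resolution, hj]).symm
  rw [hu, ← Finset.prod_sdiff hv, mul_comm, mq]
  congr 1
  · exact Finset.prod_congr rfl fun j hj => by simp [resolution, hj, hv hj]
  · refine Finset.prod_congr rfl fun j hj => ?_
    rw [Finset.mem_sdiff] at hj
    simp [resolution, hj.1, hj.2]

/-- The index of the elementary interval of resolution `K` containing the `i`-th point. -/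
def cell {d : ℕ} (b : Fin d → ℕ) (S : ℕ → Fin d → ℝ) (K : Fin d → ℕ) (i : ℕ) : Fin d → ℤ :=
  fun j => ⌊(b j : ℝ) ^ K j * S i j⌋

theorem IsEquidistributed.existsUnique_cell_eq {d : ℕ} {b : Fin d → ℕ} (hb : ∀ j, 0 < b j)
    {S : ℕ → Fin d → ℝ} (hS : IsEquidistributed b S) (K : Fin d → ℕ) (r i : ℕ) :
    ∃! i', i' ∈ Finset.Ico (r * ∏ j, b j ^ K j) ((r + 1) * ∏ j, b j ^ K j) ∧
      cell b S K i' = cell b S K i := by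
  simp only [funext_iff]
  refine hS.2 r K (cell b S K i) fun j => ?_
  have hpos : (0 : ℝ) < (b j : ℝ) ^ K j := pow_pos (Nat.cast_pos.2 (hb j)) _
  obtain ⟨h0, h1⟩ := hS.1 i j
  refine ⟨Int.floor_nonneg.2 (mul_nonneg hpos.le h0), Int.floor_lt.2 ?_⟩
  push_cast
  exact mul_lt_of_lt_one_right hpos h1

theorem IsEquidistributed.Cq_eq {d : ℕ} {b : Fin d → ℕ} {S : ℕ → Fin d → ℝ}
    (hS : IsEquidistributed b S) (u v : Finset (Fin d)) (k : Fin d → ℕ) (n : ℕ) :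
    Cq b S u v k n = ∑ i ∈ Finset.range n, ∑ i' ∈ Finset.range n,
      if cell b S (resolution u v k) i' = cell b S (resolution u v k) i then 1 else 0 := by
  have floor_zero : ∀ i j, ⌊S i j⌋ = 0 := fun i j => Int.floor_eq_zero_iff.2 (hS.1 i j)
  refine Finset.sum_congr rfl fun i _ => Finset.sum_congr rfl fun i' _ => ?_
  refine if_congr ?_ rfl rfl
  rw [funext_iff]
  refine forall_congr' fun j => ?_
  by_cases hj : j ∈ u
  · simp only [cell, resolution, hj, if_true, forall_const]
    exact eq_comm
  · simp [cell, resolution, hj, floor_zero]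

theorem statement0 {d : ℕ} (hd : 1 ≤ d) (b : Fin d → ℕ) (hb : ∀ j, 2 ≤ b j)
    (S : ℕ → Fin d → ℝ) (hS : IsEquidistributed b S)
    (u : Finset (Fin d)) (hu : u.Nonempty) (v : Finset (Fin d)) (hv : v ⊆ u)
    (k : Fin d → ℕ) (n : ℕ) (hn : 1 ≤ n) :
    (Cq b S u v k n : ℤ) =
      (n : ℤ) + (2 * (n : ℤ) - (mq b u v k : ℤ)) * ((n / mq b u v k : ℕ) : ℤ)
        - (mq b u v k : ℤ) * ((n / mq b u v k : ℕ) : ℤ) ^ 2 := by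
  have hb' : ∀ j, 0 < b j := fun j => two_pos.trans_le (hb j)
  have hm : 0 < mq b u v k := by
    rw [← prod_pow_resolution b hv k]
    exact Finset.prod_pos fun j _ => pow_pos (hb' j) _
  have hC := sum_pair_indicator_eq (cell b S (resolution u v k)) (mq b u v k) hm
    (fun r i => by
      rw [← prod_pow_resolution b hv k]
      exact hS.existsUnique_cell_eq hb' (resolution u v k) r i) n
  have hmod : ((n % mq b u v k : ℕ) : ℤ) = n - mq b u v k * ((n / mq b u v k : ℕ) : ℤ) := by
    rw [eq_sub_iff_add_eq]
    exact_mod_cast Nat.mod_add_div n (mq b u v k)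
  rw [hS.Cq_eq u v k n, hC, Nat.cast_add, Nat.cast_mul, Nat.cast_mul, hmod]
  push_cast
  ring

end
end

section
/- Let S and S′ be two equidistributed sequences in the same base b = (b_1,…,b_d). Then for every n ≥ 1, every nonempty u ⊆ {1,…,d}, every v ⊆ u, and every k ∈ ℕ_0^{|u|}, the first n points of S and the first n points of S′ have the same values of C_{u,v,k} and of the gain coefficient G_{u,k}; in other words, for equidistributed sequences these quantities depend only on n (and on u, v, k, b), not on the particular sequence. -/
open Finset MeasureTheory

noncomputable section


section BlockBijection

variable {α : Type*} [DecidableEq α]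

theorem card_filter_range_mul_of_existsUnique {c : ℕ → α} {B : ℕ} {a : α}
    (h : ∀ r, ∃! i, i ∈ Finset.Ico (r * B) ((r + 1) * B) ∧ c i = a) (q : ℕ) :
    ((Finset.range (q * B)).filter (fun i => c i = a)).card = q := by
  induction q with
  | zero => simp
  | succ q ih =>
    have hle : q * B ≤ (q + 1) * B := Nat.mul_le_mul_right _ (Nat.le_succ q)
    have hcard : ((Finset.Ico (q * B) ((q + 1) * B)).filter (fun i => c i = a)).card = 1 := by
      obtain ⟨i, hi, huniq⟩ := h q
      refine Finset.card_eq_one.2 ⟨i, Finset.ext fun x => ?_⟩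
      rw [Finset.mem_filter, Finset.mem_singleton]
      exact ⟨fun hx => huniq x hx, fun hx => hx ▸ hi⟩
    rw [Finset.card_filter] at ih hcard ⊢
    rw [← Finset.sum_range_add_sum_Ico _ hle, ih, hcard]

theorem card_filter_range_eq_div {c : ℕ → α} {B : ℕ} (hB : 0 < B)
    (h : ∀ m r, ∃! i, i ∈ Finset.Ico (r * B) ((r + 1) * B) ∧ c i = c m) (n : ℕ) :
    ((Finset.range n).filter (fun i => c i = c n)).card = n / B := by
  have hle : n / B * B ≤ n := Nat.div_mul_le_self n B
  have hlt : n < (n / B + 1) * B := by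
    rw [mul_comm]; exact Nat.lt_mul_div_succ n hB
  have hempty : ((Finset.Ico (n / B * B) n).filter (fun i => c i = c n)).card = 0 := by
    rw [Finset.card_eq_zero, Finset.filter_eq_empty_iff]
    intro i hi hc
    rw [Finset.mem_Ico] at hi
    have := (h n (n / B)).unique ⟨Finset.mem_Ico.2 ⟨hi.1, hi.2.trans hlt⟩, hc⟩
      ⟨Finset.mem_Ico.2 ⟨hle, hlt⟩, rfl⟩
    omega
  have hfull := card_filter_range_mul_of_existsUnique (h n) (n / B)
  rw [Finset.card_filter] at hempty hfull ⊢
  rw [← Finset.sum_range_add_sum_Ico _ hle, hfull, hempty, add_zero]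

theorem sum_range_pairs_eq {c : ℕ → α} {B : ℕ} (hB : 0 < B)
    (h : ∀ m r, ∃! i, i ∈ Finset.Ico (r * B) ((r + 1) * B) ∧ c i = c m) (n : ℕ) :
    (∑ i ∈ Finset.range n, ∑ i' ∈ Finset.range n, if c i = c i' then 1 else 0)
      = ∑ m ∈ Finset.range n, (2 * (m / B) + 1) := by
  induction n with
  | zero => simp
  | succ n ih =>
    have hrow := card_filter_range_eq_div hB h n
    rw [Finset.card_filter] at hrow
    have hcol : (∑ i ∈ Finset.range n, if c n = c i then 1 else 0) = n / B := by
      simpa only [eq_comm] using hrow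
    rw [Finset.sum_range_succ _ n, Finset.sum_range_succ _ n, hcol, if_pos rfl,
      Finset.sum_range_succ _ n]
    simp only [Finset.sum_range_succ _ n]
    rw [Finset.sum_add_distrib, ih, hrow]
    ring

end BlockBijection

/-- The number of pairs of points in a common elementary interval depends only on `n` and on the
number of elementary intervals. -/
theorem Cq_eq_sum_div {d : ℕ} {b : Fin d → ℕ} (hb : ∀ j, 0 < b j) {S : ℕ → Fin d → ℝ}
    (hS : IsEquidistributed b S) (u v : Finset (Fin d)) (k : Fin d → ℕ) (n : ℕ) :
    Cq b S u v k n = ∑ m ∈ Finset.range n,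
      (2 * (m / ∏ j, b j ^ (if j ∈ u then k j + (if j ∈ v then 1 else 0) else 0)) + 1) := by
  set K : Fin d → ℕ := fun j => if j ∈ u then k j + (if j ∈ v then 1 else 0) else 0 with hK
  have hB : 0 < ∏ j, b j ^ K j := Finset.prod_pos fun j _ => pow_pos (hb j) _
  have hcell : ∀ m r, ∃! i, i ∈ Finset.Ico (r * ∏ j, b j ^ K j) ((r + 1) * ∏ j, b j ^ K j) ∧
      (fun j => ⌊(b j : ℝ) ^ K j * S i j⌋) = fun j => ⌊(b j : ℝ) ^ K j * S m j⌋ := by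
    intro m r
    simp only [funext_iff]
    refine hS.2 r K _ fun j => ?_
    have hpos : (0 : ℝ) < (b j : ℝ) ^ K j := pow_pos (Nat.cast_pos.2 (hb j)) _
    refine ⟨Int.floor_nonneg.2 (mul_nonneg hpos.le (hS.1 m j).1), Int.floor_lt.2 ?_⟩
    push_cast
    exact mul_lt_of_lt_one_right hpos (hS.1 m j).2
  rw [← sum_range_pairs_eq hB hcell n, Cq]
  refine Finset.sum_congr rfl fun i _ => Finset.sum_congr rfl fun i' _ => if_congr ?_ rfl rfl
  rw [funext_iff]
  refine forall_congr' fun j => ?_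
  by_cases hj : j ∈ u
  · simp [hK, hj]
  · simp [hK, hj, Int.floor_eq_zero_iff.2 (hS.1 i j), Int.floor_eq_zero_iff.2 (hS.1 i' j)]

/-- The gain coefficient is a combination of the pair counts `Cq` with coefficients that do not
depend on the points. -/
theorem gain_eq_sum_Cq {d : ℕ} (b : Fin d → ℕ) (S : ℕ → Fin d → ℝ) (u : Finset (Fin d))
    (k : Fin d → ℕ) (n : ℕ) :
    gain b S u k n = (∏ j ∈ u, ((b j : ℝ) - 1)⁻¹) * (n : ℝ)⁻¹ *
      ∑ t ∈ u.powerset, ((-1) ^ t.card * ∏ j ∈ u \ t, (b j : ℝ)) * (Cq b S u (u \ t) k n : ℝ) := by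
  rw [gain]
  congr 1
  have hterm : ∀ i i' : ℕ, (∏ j ∈ u, ((b j : ℝ) *
            (if ⌊(b j : ℝ) ^ (k j + 1) * S i j⌋ = ⌊(b j : ℝ) ^ (k j + 1) * S i' j⌋
              then 1 else 0) -
          (if ⌊(b j : ℝ) ^ k j * S i j⌋ = ⌊(b j : ℝ) ^ k j * S i' j⌋ then 1 else 0)))
      = ∑ t ∈ u.powerset, ((-1) ^ t.card * ∏ j ∈ u \ t, (b j : ℝ)) *
        (if ∀ j ∈ u, ⌊(b j : ℝ) ^ (k j + if j ∈ u \ t then 1 else 0) * S i j⌋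
          = ⌊(b j : ℝ) ^ (k j + if j ∈ u \ t then 1 else 0) * S i' j⌋ then 1 else 0) := by
    intro i i'
    rw [Finset.prod_sub]
    refine Finset.sum_congr rfl fun t ht => ?_
    have hbool := Finset.prod_boole (M₀ := ℝ) (s := u)
      (p := fun j => ⌊(b j : ℝ) ^ (k j + if j ∈ u \ t then 1 else 0) * S i j⌋
        = ⌊(b j : ℝ) ^ (k j + if j ∈ u \ t then 1 else 0) * S i' j⌋)
    rw [← Finset.prod_sdiff (Finset.mem_powerset.1 ht)] at hbool
    rw [Finset.prod_mul_distrib, ← mul_assoc, mul_assoc]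
    refine Eq.trans ?_ (congrArg _ (hbool.trans (by congr)))
    congr 2
    · exact Finset.prod_congr rfl fun j hj => by simp only [hj, if_true]
    · exact Finset.prod_congr rfl fun j hj => by simp [hj]
  calc _ = ∑ i ∈ Finset.range n, ∑ t ∈ u.powerset, ∑ i' ∈ Finset.range n, _ :=
        Finset.sum_congr rfl fun i _ => by
          rw [Finset.sum_congr rfl fun i' _ => hterm i i', Finset.sum_comm]
    _ = _ := by
        rw [Finset.sum_comm]
        refine Finset.sum_congr rfl fun t _ => ?_
        simp only [Cq, Nat.cast_sum, Finset.mul_sum, Nat.cast_ite, Nat.cast_one, Nat.cast_zero]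

theorem statement1 {d : ℕ} (hd : 1 ≤ d) (b : Fin d → ℕ) (hb : ∀ j, 2 ≤ b j)
    (S S' : ℕ → Fin d → ℝ) (hS : IsEquidistributed b S) (hS' : IsEquidistributed b S')
    (n : ℕ) (hn : 1 ≤ n) (u : Finset (Fin d)) (hu : u.Nonempty)
    (v : Finset (Fin d)) (hv : v ⊆ u) (k : Fin d → ℕ) :
    Cq b S u v k n = Cq b S' u v k n ∧ gain b S u k n = gain b S' u k n := by
  have hpos : ∀ j, 0 < b j := fun j => two_pos.trans_le (hb j)
  have hC : ∀ w, Cq b S u w k n = Cq b S' u w k n := fun w => by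
    rw [Cq_eq_sum_div hpos hS, Cq_eq_sum_div hpos hS']
  exact ⟨hC v, by simp only [gain_eq_sum_Cq, hC]⟩

end
end

section
/- Let S be an equidistributed sequence in base b = (b_1,…,b_d) and write G_{u,k}(n) for the gain coefficient of its first n points. For every nonempty u ⊆ {1,…,d} and k ∈ ℕ_0^{|u|}, if 1 ≤ n ≤ ∏_{j∈u} b_j^{k_j}, then G_{u,k}(n) = 1. -/
open Finset MeasureTheory

noncomputable section


/-- Agreement of base-`b` cells at resolution `k + 1` implies agreement at resolution `k`. -/
theorem floor_pow_mul_eq_of_floor_pow_succ_mul_eq {b : ℕ} (hb : b ≠ 0) {k : ℕ} {x y : ℝ}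
    (h : ⌊(b : ℝ) ^ (k + 1) * x⌋ = ⌊(b : ℝ) ^ (k + 1) * y⌋) :
    ⌊(b : ℝ) ^ k * x⌋ = ⌊(b : ℝ) ^ k * y⌋ := by
  rw [pow_succ', mul_assoc, mul_assoc] at h
  rw [← Int.natCast_mul_floor_div_cancel hb ((b : ℝ) ^ k * x), h,
    Int.natCast_mul_floor_div_cancel hb]

/-- Among the first `∏ j ∈ u, b j ^ k j` points of an equidistributed sequence, no two distinct
ones share a cell of resolution `k` in the coordinates `u`. -/
theorem IsEquidistributed.eq_of_floor_eq {d : ℕ} {b : Fin d → ℕ} {S : ℕ → Fin d → ℝ}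
    (hS : IsEquidistributed b S) (hb : ∀ j, b j ≠ 0) {u : Finset (Fin d)} {k : Fin d → ℕ}
    {i i' : ℕ} (hi : i < ∏ j ∈ u, b j ^ k j) (hi' : i' < ∏ j ∈ u, b j ^ k j)
    (h : ∀ j ∈ u, ⌊(b j : ℝ) ^ k j * S i j⌋ = ⌊(b j : ℝ) ^ k j * S i' j⌋) : i = i' := by
  classical
  set l : Fin d → ℕ := fun j => if j ∈ u then k j else 0 with hl
  have hprod : ∏ j, b j ^ l j = ∏ j ∈ u, b j ^ k j := by
    simp [hl, pow_ite, Finset.prod_ite_mem]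
  have hfloor (j : Fin d) : ⌊(b j : ℝ) ^ l j * S i' j⌋ = ⌊(b j : ℝ) ^ l j * S i j⌋ := by
    by_cases hj : j ∈ u
    · simpa [hl, hj] using (h j hj).symm
    · have hzero (m : ℕ) : ⌊S m j⌋ = 0 := Int.floor_eq_zero_iff.2 (hS.1 m j)
      simp [hl, hj, hzero]
  refine (hS.2 0 l (fun j => ⌊(b j : ℝ) ^ l j * S i j⌋) fun j => ?_).unique
    ⟨by simpa [hprod] using hi, fun _ => rfl⟩ ⟨by simpa [hprod] using hi', hfloor⟩
  have hpos : (0 : ℝ) < (b j : ℝ) ^ l j := pow_pos (by exact_mod_cast (hb j).bot_lt) _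
  refine ⟨Int.floor_nonneg.2 (mul_nonneg hpos.le (hS.1 i j).1), Int.floor_lt.2 ?_⟩
  push_cast
  exact mul_lt_of_lt_one_right hpos (hS.1 i j).2

theorem statement2 {d : ℕ} (hd : 1 ≤ d) (b : Fin d → ℕ) (hb : ∀ j, 2 ≤ b j)
    (S : ℕ → Fin d → ℝ) (hS : IsEquidistributed b S)
    (u : Finset (Fin d)) (hu : u.Nonempty) (k : Fin d → ℕ)
    (n : ℕ) (hn1 : 1 ≤ n) (hn2 : n ≤ ∏ j ∈ u, b j ^ k j) :
    gain b S u k n = 1 := by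
  have hb0 (j : Fin d) : b j ≠ 0 := by have := hb j; omega
  have hb1 (j : Fin d) : (b j : ℝ) - 1 ≠ 0 := by
    have : (2 : ℝ) ≤ b j := by exact_mod_cast hb j
    linarith
  have hn0 : (n : ℝ) ≠ 0 := by exact_mod_cast (by omega : n ≠ 0)
  have hrow : ∀ i ∈ Finset.range n, (∑ i' ∈ Finset.range n, ∏ j ∈ u,
      ((b j : ℝ) *
          (if ⌊(b j : ℝ) ^ (k j + 1) * S i j⌋ = ⌊(b j : ℝ) ^ (k j + 1) * S i' j⌋
            then 1 else 0) -
        (if ⌊(b j : ℝ) ^ k j * S i j⌋ = ⌊(b j : ℝ) ^ k j * S i' j⌋ then 1 else 0))) =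
      ∏ j ∈ u, ((b j : ℝ) - 1) := by
    intro i hi
    rw [Finset.sum_eq_single_of_mem i hi]
    · simp
    · intro i' hi' hne
      obtain ⟨j, hj, hdiff⟩ : ∃ j ∈ u,
          ⌊(b j : ℝ) ^ k j * S i j⌋ ≠ ⌊(b j : ℝ) ^ k j * S i' j⌋ := by
        by_contra! hall
        exact hne (hS.eq_of_floor_eq hb0 ((Finset.mem_range.1 hi).trans_le hn2)
          ((Finset.mem_range.1 hi').trans_le hn2) hall).symm
      refine Finset.prod_eq_zero hj ?_
      rw [if_neg hdiff,
        if_neg (mt (floor_pow_mul_eq_of_floor_pow_succ_mul_eq (hb0 j)) hdiff)]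
      ring
  have hprod : ∏ j ∈ u, ((b j : ℝ) - 1) ≠ 0 := Finset.prod_ne_zero_iff.2 fun j _ => hb1 j
  rw [gain, Finset.sum_congr rfl hrow, Finset.sum_const, Finset.card_range, nsmul_eq_mul,
    Finset.prod_inv_distrib]
  field_simp

end
end

section
/- Let S be an equidistributed sequence in base b = (b_1,…,b_d) and write G_{u,k}(n) for the gain coefficient of its first n points. For every nonempty u ⊆ {1,…,d}, every k ∈ ℕ_0^{|u|}, and every r ∈ ℕ, if n = r·∏_{j∈u} b_j^{k_j+1}, then G_{u,k}(n) = 0. -/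
open Finset MeasureTheory

noncomputable section


theorem floor_pow_mul_eq_ediv {b : ℕ} (hb : 0 < b) (k : ℕ) (x : ℝ) :
    ⌊(b : ℝ) ^ k * x⌋ = ⌊(b : ℝ) ^ (k + 1) * x⌋ / (b : ℤ) := by
  have hb' : (b : ℝ) ≠ 0 := by positivity
  rw [← Int.floor_div_natCast]
  congr 1
  rw [eq_div_iff hb', pow_succ]
  ring

theorem sum_Ico_mul_indicator_sub_indicator_ediv {b : ℕ} (hb : 0 < b) (k : ℕ) {c : ℤ}
    (hc : c ∈ Finset.Ico (0 : ℤ) ((b : ℤ) ^ (k + 1))) :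
    ∑ a ∈ Finset.Ico (0 : ℤ) ((b : ℤ) ^ (k + 1)),
      ((b : ℝ) * (if c = a then 1 else 0) -
        (if c / (b : ℤ) = a / (b : ℤ) then 1 else 0)) = 0 := by
  have hb' : (0 : ℤ) < b := by exact_mod_cast hb
  have hfilter : (Finset.Ico (0 : ℤ) ((b : ℤ) ^ (k + 1))).filter
      (fun a => c / (b : ℤ) = a / (b : ℤ)) =
      Finset.Ico (b * (c / b) : ℤ) (b * (c / b) + b) := by
    rw [Finset.mem_Ico] at hc
    have h0 : 0 ≤ c / (b : ℤ) := Int.ediv_nonneg hc.1 hb'.le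
    have h1 : c / (b : ℤ) < (b : ℤ) ^ k :=
      Int.ediv_lt_of_lt_mul hb' (by rw [← pow_succ]; exact hc.2)
    ext a
    simp only [Finset.mem_filter, Finset.mem_Ico]
    constructor
    · rintro ⟨-, h⟩
      rw [h]
      have := Int.mul_ediv_add_emod a b
      have := Int.emod_nonneg a hb'.ne'
      have := Int.emod_lt_of_pos a hb'
      constructor <;> linarith
    · rintro ⟨h2, h3⟩
      refine ⟨⟨le_trans (by positivity) h2, lt_of_lt_of_le h3 ?_⟩, ?_⟩
      · rw [pow_succ]
        nlinarith
      · symm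
        rw [Int.ediv_eq_iff_of_pos hb']
        constructor <;> linarith
  rw [Finset.sum_sub_distrib, ← Finset.mul_sum, Finset.sum_ite_eq, if_pos hc,
    Finset.sum_boole, hfilter]
  simp

theorem IsEquidistributed.floor_mem_Ico {d : ℕ} {b : Fin d → ℕ} (hb : ∀ j, 0 < b j)
    {S : ℕ → Fin d → ℝ} (hS : IsEquidistributed b S) (K : Fin d → ℕ) (i : ℕ) (j : Fin d) :
    ⌊(b j : ℝ) ^ K j * S i j⌋ ∈ Finset.Ico (0 : ℤ) ((b j : ℤ) ^ K j) := by
  obtain ⟨h0, h1⟩ := hS.1 i j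
  have hpos : (0 : ℝ) < (b j : ℝ) ^ K j := pow_pos (by exact_mod_cast hb j) _
  rw [Finset.mem_Ico, Int.floor_nonneg, Int.floor_lt]
  push_cast
  exact ⟨mul_nonneg hpos.le h0, mul_lt_of_lt_one_right hpos h1⟩

/-- Summing a function of the elementary interval over one block of an equidistributed sequence
is the same as summing it over all elementary intervals. -/
theorem IsEquidistributed.sum_block {d : ℕ} {b : Fin d → ℕ} (hb : ∀ j, 0 < b j)
    {S : ℕ → Fin d → ℝ} (hS : IsEquidistributed b S) (K : Fin d → ℕ) (r : ℕ)
    (F : (Fin d → ℤ) → ℝ) :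
    ∑ i ∈ Finset.Ico (r * ∏ j, b j ^ K j) ((r + 1) * ∏ j, b j ^ K j),
      F (fun j => ⌊(b j : ℝ) ^ K j * S i j⌋) =
    ∑ a ∈ Fintype.piFinset (fun j => Finset.Ico (0 : ℤ) ((b j : ℤ) ^ K j)), F a := by
  have hmem := hS.floor_mem_Ico hb K
  refine Finset.sum_nbij (fun i j => ⌊(b j : ℝ) ^ K j * S i j⌋) ?_ ?_ ?_ (fun _ _ => rfl)
  · intro i _
    exact Fintype.mem_piFinset.2 (hmem i)
  · intro i hi i' hi' h
    exact (hS.2 r K (fun j => ⌊(b j : ℝ) ^ K j * S i j⌋)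
      (fun j => Finset.mem_Ico.1 (hmem i j))).unique
      ⟨hi, fun _ => rfl⟩ ⟨hi', fun j => (congrFun h j).symm⟩
  · intro a ha
    obtain ⟨i, ⟨hi, h⟩, -⟩ := hS.2 r K a
      (fun j => Finset.mem_Ico.1 (Fintype.mem_piFinset.1 ha j))
    exact ⟨i, hi, funext h⟩

theorem IsEquidistributed.sum_range_mul {d : ℕ} {b : Fin d → ℕ} (hb : ∀ j, 0 < b j)
    {S : ℕ → Fin d → ℝ} (hS : IsEquidistributed b S) (K : Fin d → ℕ) (r : ℕ)
    (F : (Fin d → ℤ) → ℝ) :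
    ∑ i ∈ Finset.range (r * ∏ j, b j ^ K j), F (fun j => ⌊(b j : ℝ) ^ K j * S i j⌋) =
    r * ∑ a ∈ Fintype.piFinset (fun j => Finset.Ico (0 : ℤ) ((b j : ℤ) ^ K j)), F a := by
  induction r with
  | zero => simp
  | succ r ih =>
    rw [Finset.range_eq_Ico] at ih ⊢
    rw [← Finset.sum_Ico_consecutive _ (Nat.zero_le (r * ∏ j, b j ^ K j))
      (Nat.mul_le_mul_right _ r.le_succ), ih, hS.sum_block hb]
    push_cast
    ring

theorem statement3 {d : ℕ} (hd : 1 ≤ d) (b : Fin d → ℕ) (hb : ∀ j, 2 ≤ b j)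
    (S : ℕ → Fin d → ℝ) (hS : IsEquidistributed b S)
    (u : Finset (Fin d)) (hu : u.Nonempty) (k : Fin d → ℕ)
    (r : ℕ) (hr : 1 ≤ r) :
    gain b S u k (r * ∏ j ∈ u, b j ^ (k j + 1)) = 0 := by
  have hb' : ∀ j, 0 < b j := fun j => two_pos.trans_le (hb j)
  obtain ⟨j₀, hj₀⟩ := hu
  unfold gain
  refine mul_eq_zero_of_right _ (Finset.sum_eq_zero fun i _ => ?_)
  set K : Fin d → ℕ := fun j => if j ∈ u then k j + 1 else 0
  have hK : ∀ j ∈ u, K j = k j + 1 := fun j hj => if_pos hj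
  have hB : ∏ j ∈ u, b j ^ (k j + 1) = ∏ j, b j ^ K j := by
    rw [← Finset.prod_subset (Finset.subset_univ u)
      (fun j _ hj => by simp [K, hj])]
    exact Finset.prod_congr rfl fun j hj => by rw [hK j hj]
  let f : Fin d → ℤ → ℝ := fun j a =>
    if j ∈ u then
      (b j : ℝ) * (if ⌊(b j : ℝ) ^ K j * S i j⌋ = a then 1 else 0) -
        (if ⌊(b j : ℝ) ^ K j * S i j⌋ / (b j : ℤ) = a / (b j : ℤ) then 1 else 0)
    else 1
  have hzero : ∏ j, ∑ a ∈ Finset.Ico (0 : ℤ) ((b j : ℤ) ^ K j), f j a = 0 := by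
    refine Finset.prod_eq_zero (Finset.mem_univ j₀) ?_
    have hmem := hS.floor_mem_Ico hb' K i j₀
    simp only [f, if_pos hj₀]
    rw [hK j₀ hj₀] at hmem ⊢
    exact sum_Ico_mul_indicator_sub_indicator_ediv (hb' j₀) (k j₀) hmem
  have hf := hS.sum_range_mul hb' K r (fun a => ∏ j, f j (a j))
  rw [← Finset.prod_univ_sum, hzero, mul_zero] at hf
  rw [hB]
  refine Eq.trans ?_ hf
  refine Finset.sum_congr rfl fun i' _ => ?_
  rw [← Finset.prod_subset (f := fun j => f j ⌊(b j : ℝ) ^ K j * S i' j⌋)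
    (Finset.subset_univ u) (fun j _ hj => by simp [f, hj])]
  refine Finset.prod_congr rfl fun j hj => ?_
  simp only [f, if_pos hj, hK j hj, floor_pow_mul_eq_ediv (hb' j) (k j)]

end
end

section
/- Let S be an equidistributed sequence in base b = (b_1,…,b_d) and write G_{u,k}(n) for the gain coefficient of its first n points. For every nonempty u ⊆ {1,…,d} and k ∈ ℕ_0^{|u|}, set M := ∏_{j∈u} b_j^{k_j+1}. If n = q·M + r with q, r ∈ ℕ and 0 < r < M, then G_{u,k}(n) = (r/n)·G_{u,k}(r). -/
open Finset MeasureTheory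

noncomputable section


/-- If each aligned block of length `m` contains exactly one index related to `y`, then `q`
consecutive aligned blocks contain exactly `q` of them. -/
theorem sum_blocks_eq {R : ℕ → ℕ → Prop} [∀ i y, Decidable (R i y)] {m : ℕ}
    (hR : ∀ t y, ∃! i, i ∈ Finset.Ico (t * m) ((t + 1) * m) ∧ R i y) (t y q : ℕ) :
    ∑ i ∈ range (q * m), (if R (t * m + i) y then (1 : ℝ) else 0) = q := by
  induction q with
  | zero => simp
  | succ q ih =>
    rw [add_mul, one_mul, sum_range_add, ih]
    obtain ⟨i₀, ⟨hi₀, h₀⟩, huniq⟩ := hR (t + q) y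
    rw [Finset.mem_Ico] at hi₀
    obtain ⟨e, rfl⟩ := Nat.exists_eq_add_of_le hi₀.1
    have he : e < m := by nlinarith
    have hshift : ∀ i, t * m + (q * m + i) = (t + q) * m + i := fun i => by ring
    simp only [hshift]
    rw [sum_eq_single_of_mem e (mem_range.2 he), if_pos h₀]
    · push_cast
      ring
    · intro i hi hne
      refine if_neg fun h => hne ?_
      have := huniq ((t + q) * m + i)
        ⟨Finset.mem_Ico.2 ⟨by omega, by rw [mem_range] at hi; nlinarith⟩, h⟩
      omega

/-- The number of indices in an aligned window related to the index just past it. -/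
theorem sum_range_related_next {R : ℕ → ℕ → Prop} [∀ i y, Decidable (R i y)] {m : ℕ} (hm : 0 < m)
    (hrefl : ∀ i, R i i)
    (hR : ∀ t y, ∃! i, i ∈ Finset.Ico (t * m) ((t + 1) * m) ∧ R i y) (t r : ℕ) :
    ∑ i ∈ range r, (if R (t * m + i) (t * m + r) then (1 : ℝ) else 0) = (r / m : ℕ) := by
  have hr : r / m * m + r % m = r := Nat.div_add_mod' r m
  have hlt := Nat.mod_lt r hm
  generalize r / m = q, r % m = e at hr hlt
  subst hr
  rw [sum_range_add, sum_blocks_eq hR, add_eq_left]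
  have hshift : ∀ i, t * m + (q * m + i) = (t + q) * m + i := fun i => by ring
  simp only [hshift]
  refine sum_eq_zero fun i hi => if_neg fun h => ?_
  rw [mem_range] at hi
  have := (hR (t + q) ((t + q) * m + e)).unique
    ⟨Finset.mem_Ico.2 ⟨by omega, by nlinarith⟩, h⟩
    ⟨Finset.mem_Ico.2 ⟨by omega, by nlinarith⟩, hrefl _⟩
  omega

/-- The number of related pairs in an aligned window depends only on its length. -/
theorem sum_related_pairs {R : ℕ → ℕ → Prop} [∀ i y, Decidable (R i y)] {m : ℕ} (hm : 0 < m)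
    (hrefl : ∀ i, R i i) (hsymm : ∀ i y, R i y ↔ R y i)
    (hR : ∀ t y, ∃! i, i ∈ Finset.Ico (t * m) ((t + 1) * m) ∧ R i y) (t r : ℕ) :
    ∑ i ∈ range r, ∑ i' ∈ range r, (if R (t * m + i) (t * m + i') then (1 : ℝ) else 0) =
      ∑ i ∈ range r, (2 * (i / m : ℕ) + 1 : ℝ) := by
  induction r with
  | zero => simp
  | succ r ih =>
    have hrow : ∑ i ∈ range r, (if R (t * m + r) (t * m + i) then (1 : ℝ) else 0) =
        (r / m : ℕ) := by
      rw [← sum_range_related_next hm hrefl hR t r]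
      exact sum_congr rfl fun i _ => if_congr (hsymm _ _) rfl rfl
    simp only [sum_range_succ, sum_add_distrib] at ih ⊢
    rw [ih, hrow, sum_range_related_next hm hrefl hR t r, if_pos (hrefl _)]
    ring

/-- `i` and `y` index points in the same elementary `κ`-interval in the coordinates of `u`. -/
def SameCell {d : ℕ} (b : Fin d → ℕ) (S : ℕ → Fin d → ℝ) (u : Finset (Fin d))
    (κ : Fin d → ℕ) (i y : ℕ) : Prop :=
  ∀ j ∈ u, ⌊(b j : ℝ) ^ κ j * S i j⌋ = ⌊(b j : ℝ) ^ κ j * S y j⌋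

instance {d : ℕ} (b : Fin d → ℕ) (S : ℕ → Fin d → ℝ) (u : Finset (Fin d))
    (κ : Fin d → ℕ) (i y : ℕ) : Decidable (SameCell b S u κ i y) :=
  inferInstanceAs (Decidable (∀ j ∈ u, _))

theorem IsEquidistributed.existsUnique_sameCell {d : ℕ} {b : Fin d → ℕ} (hb : ∀ j, 2 ≤ b j)
    {S : ℕ → Fin d → ℝ} (hS : IsEquidistributed b S) (u : Finset (Fin d)) (κ : Fin d → ℕ)
    (t y : ℕ) :
    ∃! i, i ∈ Finset.Ico (t * ∏ j ∈ u, b j ^ κ j) ((t + 1) * ∏ j ∈ u, b j ^ κ j) ∧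
      SameCell b S u κ i y := by
  have hprod : ∏ j, b j ^ (if j ∈ u then κ j else 0) = ∏ j ∈ u, b j ^ κ j := by
    simp [pow_ite, prod_ite_mem]
  have h := hS.2 t (fun j => if j ∈ u then κ j else 0)
    (fun j => ⌊(b j : ℝ) ^ (if j ∈ u then κ j else 0) * S y j⌋) fun j => by
      have hpos : (0 : ℝ) < (b j : ℝ) ^ (if j ∈ u then κ j else 0) := by
        have : 0 < b j := by linarith [hb j]
        positivity
      refine ⟨Int.floor_nonneg.2 (mul_nonneg hpos.le (hS.1 y j).1), Int.floor_lt.2 ?_⟩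
      push_cast
      exact mul_lt_of_lt_one_right hpos (hS.1 y j).2
  rw [hprod] at h
  refine (existsUnique_congr fun i => and_congr_right fun _ => ?_).1 h
  refine forall_congr' fun j => ?_
  by_cases hj : j ∈ u
  · simp [hj]
  · simp [hj, Int.floor_eq_zero_iff.2 (hS.1 _ j)]

theorem prod_resolution_pos {d : ℕ} {b : Fin d → ℕ} (hb : ∀ j, 2 ≤ b j) (u : Finset (Fin d))
    (κ : Fin d → ℕ) : 0 < ∏ j ∈ u, b j ^ κ j :=
  prod_pos fun j _ => pow_pos (by linarith [hb j]) _

theorem prod_resolution_dvd {d : ℕ} (b : Fin d → ℕ) (u v : Finset (Fin d)) (k : Fin d → ℕ) :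
    ∏ j ∈ u, b j ^ (k j + if j ∈ v then 1 else 0) ∣ ∏ j ∈ u, b j ^ (k j + 1) :=
  prod_dvd_prod_of_dvd _ _ fun j _ => pow_dvd_pow _ (by split_ifs <;> omega)

theorem sameCell_comm {d : ℕ} (b : Fin d → ℕ) (S : ℕ → Fin d → ℝ) (u : Finset (Fin d))
    (κ : Fin d → ℕ) (i y : ℕ) : SameCell b S u κ i y ↔ SameCell b S u κ y i :=
  forall₂_congr fun _ _ => eq_comm

/-- The contribution of the pair of points `i`, `y` to the gain coefficient. -/
def gainKernel {d : ℕ} (b : Fin d → ℕ) (S : ℕ → Fin d → ℝ) (u : Finset (Fin d))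
    (k : Fin d → ℕ) (i y : ℕ) : ℝ :=
  ∏ j ∈ u,
      ((b j : ℝ) *
          (if ⌊(b j : ℝ) ^ (k j + 1) * S i j⌋ = ⌊(b j : ℝ) ^ (k j + 1) * S y j⌋
            then 1 else 0) -
        (if ⌊(b j : ℝ) ^ k j * S i j⌋ = ⌊(b j : ℝ) ^ k j * S y j⌋ then 1 else 0))

theorem gain_eq_sum_gainKernel {d : ℕ} (b : Fin d → ℕ) (S : ℕ → Fin d → ℝ)
    (u : Finset (Fin d)) (k : Fin d → ℕ) (n : ℕ) :
    gain b S u k n = (∏ j ∈ u, ((b j : ℝ) - 1)⁻¹) * (n : ℝ)⁻¹ *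
      ∑ i ∈ range n, ∑ i' ∈ range n, gainKernel b S u k i i' := rfl

theorem gainKernel_comm {d : ℕ} (b : Fin d → ℕ) (S : ℕ → Fin d → ℝ) (u : Finset (Fin d))
    (k : Fin d → ℕ) (i y : ℕ) : gainKernel b S u k i y = gainKernel b S u k y i :=
  prod_congr rfl fun _ _ => by simp only [eq_comm]

/-- The gain kernel is a signed combination of cell indicators. -/
theorem gainKernel_eq_sum_powerset {d : ℕ} (b : Fin d → ℕ) (S : ℕ → Fin d → ℝ)
    (u : Finset (Fin d)) (k : Fin d → ℕ) (i y : ℕ) :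
    gainKernel b S u k i y =
      ∑ v ∈ u.powerset, ((∏ j ∈ v, (b j : ℝ)) * ∏ _j ∈ u \ v, (-1 : ℝ)) *
        if SameCell b S u (fun j => k j + if j ∈ v then 1 else 0) i y then 1 else 0 := by
  simp_rw [gainKernel, sub_eq_add_neg]
  rw [prod_add]
  refine sum_congr rfl fun v hv => ?_
  rw [mem_powerset] at hv
  have hcell : (if SameCell b S u (fun j => k j + if j ∈ v then 1 else 0) i y
      then (1 : ℝ) else 0) =
      (∏ j ∈ v, if ⌊(b j : ℝ) ^ (k j + 1) * S i j⌋ = ⌊(b j : ℝ) ^ (k j + 1) * S y j⌋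
        then (1 : ℝ) else 0) *
      ∏ j ∈ u \ v, if ⌊(b j : ℝ) ^ k j * S i j⌋ = ⌊(b j : ℝ) ^ k j * S y j⌋
        then (1 : ℝ) else 0 := by
    have hiff : SameCell b S u (fun j => k j + if j ∈ v then 1 else 0) i y ↔
        (∀ j ∈ v, ⌊(b j : ℝ) ^ (k j + 1) * S i j⌋ = ⌊(b j : ℝ) ^ (k j + 1) * S y j⌋) ∧
          ∀ j ∈ u \ v, ⌊(b j : ℝ) ^ k j * S i j⌋ = ⌊(b j : ℝ) ^ k j * S y j⌋ := by
      refine ⟨fun h => ⟨fun j hj => ?_, fun j hj => ?_⟩, fun h j hj => ?_⟩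
      · simpa [hj] using h j (hv hj)
      · rw [mem_sdiff] at hj
        simpa [hj.2] using h j hj.1
      · by_cases hjv : j ∈ v
        · simpa [hjv] using h.1 j hjv
        · simpa [hjv] using h.2 j (mem_sdiff.2 ⟨hj, hjv⟩)
    rw [prod_boole, prod_boole]
    split_ifs <;> first | rfl | (exfalso; tauto) | simp
  rw [hcell, mul_mul_mul_comm, ← prod_mul_distrib, ← prod_mul_distrib]
  simp only [neg_one_mul]

theorem sum_powerset_div_eq_zero {d : ℕ} {b : Fin d → ℕ} (hb : ∀ j, 2 ≤ b j)
    {u : Finset (Fin d)} (hu : u.Nonempty) (k : Fin d → ℕ) :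
    ∑ v ∈ u.powerset, ((∏ j ∈ v, (b j : ℝ)) * ∏ _j ∈ u \ v, (-1 : ℝ)) *
      ((∏ j ∈ u, b j ^ (k j + if j ∈ v then 1 else 0) : ℕ) : ℝ)⁻¹ = 0 := by
  have hb0 : ∀ j, (b j : ℝ) ≠ 0 := fun j => by
    have := hb j
    positivity
  have hexp : ∏ j ∈ u, ((b j : ℝ) * ((b j : ℝ) ^ (k j + 1))⁻¹ + -1 * ((b j : ℝ) ^ k j)⁻¹) = 0 := by
    obtain ⟨j, hj⟩ := hu
    refine prod_eq_zero hj ?_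
    have := hb0 j
    field_simp
    ring
  rw [prod_add] at hexp
  rw [← hexp]
  refine sum_congr rfl fun v hv => ?_
  rw [mem_powerset] at hv
  rw [prod_mul_distrib, prod_mul_distrib, mul_mul_mul_comm]
  congr 1
  push_cast
  rw [← prod_inv_distrib, ← prod_sdiff hv, mul_comm]
  congr 1
  · exact prod_congr rfl fun _ hj => by simp [hj]
  · exact prod_congr rfl fun _ hj => by simp [(mem_sdiff.1 hj).2]

/-- Over consecutive aligned blocks of full resolution, the gain kernel cancels. -/
theorem IsEquidistributed.sum_gainKernel_blocks_eq_zero {d : ℕ} {b : Fin d → ℕ}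
    (hb : ∀ j, 2 ≤ b j) {S : ℕ → Fin d → ℝ} (hS : IsEquidistributed b S) {u : Finset (Fin d)}
    (hu : u.Nonempty) (k : Fin d → ℕ) (q y : ℕ) :
    ∑ i ∈ range (q * ∏ j ∈ u, b j ^ (k j + 1)), gainKernel b S u k i y = 0 := by
  simp_rw [gainKernel_eq_sum_powerset]
  rw [sum_comm]
  refine Eq.trans ?_ ((congrArg (((q * ∏ j ∈ u, b j ^ (k j + 1) : ℕ) : ℝ) * ·)
    (sum_powerset_div_eq_zero hb hu k)).trans (mul_zero _))
  rw [mul_sum]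
  refine sum_congr rfl fun v _ => ?_
  rw [← mul_sum, mul_left_comm]
  congr 1
  have hR := hS.existsUnique_sameCell hb u (fun j => k j + if j ∈ v then 1 else 0)
  obtain ⟨c, hc⟩ := prod_resolution_dvd b u v k
  have hpos := prod_resolution_pos hb u (fun j => k j + if j ∈ v then 1 else 0)
  have := sum_blocks_eq hR 0 y (q * c)
  rw [hc]
  generalize ∏ j ∈ u, b j ^ (k j + if j ∈ v then 1 else 0) = m at *
  have hm : (m : ℝ) ≠ 0 := by positivity
  rw [show q * (m * c) = q * c * m by ring]
  simp only [zero_mul, zero_add] at this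
  rw [this]
  push_cast
  field_simp

/-- Translating by a multiple of the full resolution preserves the gain kernel sum. -/
theorem IsEquidistributed.sum_gainKernel_add {d : ℕ} {b : Fin d → ℕ} (hb : ∀ j, 2 ≤ b j)
    {S : ℕ → Fin d → ℝ} (hS : IsEquidistributed b S) (u : Finset (Fin d)) (k : Fin d → ℕ)
    (q r : ℕ) :
    ∑ i ∈ range r, ∑ i' ∈ range r, gainKernel b S u k
        (q * (∏ j ∈ u, b j ^ (k j + 1)) + i) (q * (∏ j ∈ u, b j ^ (k j + 1)) + i') =
      ∑ i ∈ range r, ∑ i' ∈ range r, gainKernel b S u k i i' := by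
  simp_rw [gainKernel_eq_sum_powerset, sum_comm (s := range r) (t := u.powerset), ← mul_sum]
  refine sum_congr rfl fun v _ => ?_
  congr 1
  obtain ⟨c, hc⟩ := prod_resolution_dvd b u v k
  have hpairs := sum_related_pairs (prod_resolution_pos hb u _) (fun i j _ => rfl)
    (sameCell_comm b S u _)
    (hS.existsUnique_sameCell hb u (fun j => k j + if j ∈ v then 1 else 0))
  have hshift := (hpairs (q * c) r).trans (hpairs 0 r).symm
  simp only [zero_mul, zero_add] at hshift
  rwa [hc, mul_comm _ c, ← mul_assoc]

theorem statement4 {d : ℕ} (hd : 1 ≤ d) (b : Fin d → ℕ) (hb : ∀ j, 2 ≤ b j)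
    (S : ℕ → Fin d → ℝ) (hS : IsEquidistributed b S)
    (u : Finset (Fin d)) (hu : u.Nonempty) (k : Fin d → ℕ)
    (q r : ℕ) (hq : 1 ≤ q) (hr0 : 0 < r) (hrM : r < ∏ j ∈ u, b j ^ (k j + 1)) :
    gain b S u k (q * (∏ j ∈ u, b j ^ (k j + 1)) + r) =
      (r : ℝ) / ((q * (∏ j ∈ u, b j ^ (k j + 1)) + r : ℕ) : ℝ) * gain b S u k r := by
  have hzero := fun y => hS.sum_gainKernel_blocks_eq_zero hb hu k q y
  have htail := hS.sum_gainKernel_add hb u k q r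
  simp only [gain_eq_sum_gainKernel]
  generalize ∏ j ∈ u, b j ^ (k j + 1) = M at *
  have hzero' : ∀ y, ∑ i ∈ range (q * M), gainKernel b S u k y i = 0 := fun y => by
    rw [← hzero y]
    exact sum_congr rfl fun i _ => gainKernel_comm b S u k y i
  have hsum : ∑ i ∈ range (q * M + r), ∑ i' ∈ range (q * M + r), gainKernel b S u k i i' =
      ∑ i ∈ range r, ∑ i' ∈ range r, gainKernel b S u k i i' := by
    simp_rw [← htail, sum_range_add _ (q * M) r, hzero', zero_add]
    rw [add_eq_right, sum_comm]
    exact sum_eq_zero fun i _ => hzero _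
  rw [hsum]
  have hr : (r : ℝ) ≠ 0 := by positivity
  field_simp

end
end

section
/- Let b ≥ 2 be an integer, e_1,…,e_d ∈ ℕ, and let S be an equidistributed sequence in base (b^{e_1},…,b^{e_d}); write G_{u,k}(n) for the gain coefficient of its first n points in this base. Fix a nonempty u ⊆ {1,…,d}, let j_m ∈ u minimize e_j over j ∈ u, and set Γ_u := ∏_{j∈u∖{j_m}} b^{e_j}/(b^{e_j}−1) (empty product = 1). Then for every k ∈ ℕ_0^{|u|}: (a) G_{u,k}(n) ≤ Γ_u for all n ∈ ℕ; and for n = b^m with m ∈ ℕ_0: (b) G_{u,k}(b^m) = 0 if Σ_{j∈u} e_j(k_j+1) ≤ m, and (c) G_{u,k}(b^m) = 1 if Σ_{j∈u} e_j k_j ≥ m (with m ≥ 1 in case (c)). -/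
open Finset MeasureTheory

noncomputable section


/-- A real kernel on `ℕ` that is a finite sum of kernels `(i, i') ↦ f i * f i'`. -/
def IsGramKernel (A : ℕ → ℕ → ℝ) : Prop :=
  ∃ (ι : Type) (_ : Fintype ι) (φ : ι → ℕ → ℝ), ∀ i i', A i i' = ∑ l, φ l i * φ l i'

namespace IsGramKernel

variable {A B : ℕ → ℕ → ℝ}

theorem sum_nonneg (hA : IsGramKernel A) (n : ℕ) :
    0 ≤ ∑ i ∈ range n, ∑ i' ∈ range n, A i i' := by
  obtain ⟨ι, _, φ, h⟩ := hA
  have : ∑ i ∈ range n, ∑ i' ∈ range n, A i i' = ∑ l, (∑ i ∈ range n, φ l i) ^ 2 := by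
    simp_rw [h, sq, Finset.sum_mul_sum]
    rw [Finset.sum_comm (s := univ)]
    exact Finset.sum_congr rfl fun i _ => Finset.sum_comm
  rw [this]
  positivity

theorem add (hA : IsGramKernel A) (hB : IsGramKernel B) :
    IsGramKernel fun i i' => A i i' + B i i' := by
  obtain ⟨ι, _, φ, h⟩ := hA
  obtain ⟨κ, _, ψ, h'⟩ := hB
  exact ⟨ι ⊕ κ, inferInstance, Sum.elim φ ψ, fun i i' => by simp [h, h']⟩

theorem mul (hA : IsGramKernel A) (hB : IsGramKernel B) :
    IsGramKernel fun i i' => A i i' * B i i' := by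
  obtain ⟨ι, _, φ, h⟩ := hA
  obtain ⟨κ, _, ψ, h'⟩ := hB
  refine ⟨ι × κ, inferInstance, fun l i => φ l.1 i * ψ l.2 i, fun i i' => ?_⟩
  simp only [h, h']
  rw [Finset.sum_mul_sum, Fintype.sum_prod_type]
  exact Finset.sum_congr rfl fun _ _ => Finset.sum_congr rfl fun _ _ => by ring

theorem rank_one (f : ℕ → ℝ) : IsGramKernel fun i i' => f i * f i' :=
  ⟨Unit, inferInstance, fun _ => f, by simp⟩

theorem const_mul (hA : IsGramKernel A) {c : ℝ} (hc : 0 ≤ c) :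
    IsGramKernel fun i i' => c * A i i' := by
  have := (rank_one fun _ => √c).mul hA
  simpa [Real.mul_self_sqrt hc] using this

theorem prod {α : Type*} (s : Finset α) {P : α → ℕ → ℕ → ℝ}
    (hP : ∀ j ∈ s, IsGramKernel (P j)) : IsGramKernel fun i i' => ∏ j ∈ s, P j i i' := by
  classical
  induction s using Finset.induction_on with
  | empty => simpa using rank_one fun _ => 1
  | insert a s ha ih =>
    simp_rw [Finset.prod_insert ha]
    exact (hP a (by simp)).mul (ih fun j hj => hP j (by simp [hj]))

/-- Products of Gram kernels are monotone for the Loewner order. -/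
theorem prod_sub_prod {α : Type*} (s : Finset α) {P Q : α → ℕ → ℕ → ℝ}
    (hP : ∀ j ∈ s, IsGramKernel (P j))
    (hQP : ∀ j ∈ s, IsGramKernel fun i i' => Q j i i' - P j i i') :
    IsGramKernel fun i i' => ∏ j ∈ s, Q j i i' - ∏ j ∈ s, P j i i' := by
  classical
  induction s using Finset.induction_on with
  | empty => simpa using rank_one fun _ => 0
  | insert a s ha ih =>
    have hQ : ∀ j ∈ s, IsGramKernel (Q j) := fun j hj => by
      simpa using (hQP j (by simp [hj])).add (hP j (by simp [hj]))
    have key := ((hQP a (by simp)).mul (prod s hQ)).add ((hP a (by simp)).mul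
      (ih (fun j hj => hP j (by simp [hj])) fun j hj => hQP j (by simp [hj])))
    simp_rw [Finset.prod_insert ha]
    convert key using 3
    ring

end IsGramKernel

/-- Indicator that the points `i` and `i'` agree in coordinate `j` at resolution `κ`. -/
def sameCell {d : ℕ} (b : Fin d → ℕ) (S : ℕ → Fin d → ℝ) (j : Fin d) (κ i i' : ℕ) : ℝ :=
  if ⌊(b j : ℝ) ^ κ * S i j⌋ = ⌊(b j : ℝ) ^ κ * S i' j⌋ then 1 else 0

section

variable {d : ℕ} {b : Fin d → ℕ} {S : ℕ → Fin d → ℝ}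

theorem floor_pow_mul_mem (hb : ∀ j, 1 ≤ b j) (hS : ∀ i j, S i j ∈ Set.Ico (0 : ℝ) 1)
    (j : Fin d) (κ i : ℕ) :
    0 ≤ ⌊(b j : ℝ) ^ κ * S i j⌋ ∧ ⌊(b j : ℝ) ^ κ * S i j⌋ < (b j : ℤ) ^ κ := by
  have hpos : (0 : ℝ) < (b j : ℝ) ^ κ := by
    have := hb j
    positivity
  obtain ⟨h0, h1⟩ := hS i j
  refine ⟨Int.floor_nonneg.2 (by positivity), Int.floor_lt.2 ?_⟩
  push_cast
  nlinarith

theorem floor_pow_succ_ediv (hb : ∀ j, 1 ≤ b j) (j : Fin d) (κ i : ℕ) :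
    ⌊(b j : ℝ) ^ (κ + 1) * S i j⌋ / (b j : ℤ) = ⌊(b j : ℝ) ^ κ * S i j⌋ := by
  have h : (b j : ℝ) ≠ 0 := by
    have := hb j
    positivity
  have h2 : (b j : ℝ) ^ κ * S i j = ((b j : ℝ) ^ (κ + 1) * S i j) / (b j : ℝ) := by
    rw [pow_succ]
    field_simp
  rw [h2, Int.floor_div_natCast]

theorem isGramKernel_sameCell (hb : ∀ j, 1 ≤ b j) (hS : ∀ i j, S i j ∈ Set.Ico (0 : ℝ) 1)
    (j : Fin d) (κ : ℕ) : IsGramKernel (sameCell b S j κ) := by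
  refine ⟨Finset.Ico (0 : ℤ) ((b j : ℤ) ^ κ), inferInstance,
    fun c i => if ⌊(b j : ℝ) ^ κ * S i j⌋ = c then 1 else 0, fun i i' => ?_⟩
  rw [Finset.sum_coe_sort (Finset.Ico (0 : ℤ) ((b j : ℤ) ^ κ)) fun c =>
    (if ⌊(b j : ℝ) ^ κ * S i j⌋ = c then (1 : ℝ) else 0) *
      if ⌊(b j : ℝ) ^ κ * S i' j⌋ = c then 1 else 0]
  simp only [ite_mul, one_mul, zero_mul, Finset.sum_ite_eq]
  rw [if_pos (Finset.mem_Ico.2 (floor_pow_mul_mem hb hS j κ i))]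
  simp only [sameCell, eq_comm]

theorem card_ediv_eq {B : ℕ} (hB : 1 ≤ B) {N a : ℤ} (ha : 0 ≤ a) (haN : a < N) :
    #{c ∈ Finset.Ico (0 : ℤ) (N * B) | c / (B : ℤ) = a} = B := by
  have hB' : (0 : ℤ) < B := by exact_mod_cast hB
  have : {c ∈ Finset.Ico (0 : ℤ) (N * B) | c / (B : ℤ) = a} = Finset.Ico (a * B) (a * B + B) := by
    ext c
    simp only [Finset.mem_filter, Finset.mem_Ico]
    rw [Int.ediv_eq_iff_of_pos hB']
    constructor
    · rintro ⟨_, h⟩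
      constructor <;> nlinarith
    · rintro ⟨h1, h2⟩
      refine ⟨⟨by nlinarith, by nlinarith⟩, by nlinarith, by nlinarith⟩
  rw [this]
  simp

theorem isGramKernel_mul_sameCell_sub (hb : ∀ j, 1 ≤ b j)
    (hS : ∀ i j, S i j ∈ Set.Ico (0 : ℝ) 1) (j : Fin d) (κ : ℕ) :
    IsGramKernel fun i i' => (b j : ℝ) * sameCell b S j (κ + 1) i i' - sameCell b S j κ i i' := by
  set I := Finset.Ico (0 : ℤ) ((b j : ℤ) ^ (κ + 1)) with hI
  set F : ℕ → ℤ := fun i => ⌊(b j : ℝ) ^ (κ + 1) * S i j⌋ with hF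
  set P : ℕ → ℤ := fun i => ⌊(b j : ℝ) ^ κ * S i j⌋ with hP
  have hFP : ∀ i, F i / (b j : ℤ) = P i := fun i => floor_pow_succ_ediv hb j κ i
  have hFI : ∀ i, F i ∈ I := fun i => Finset.mem_Ico.2 (floor_pow_mul_mem hb hS j (κ + 1) i)
  have hb0 : (0 : ℝ) < b j := by
    have := hb j
    positivity
  have hgram : IsGramKernel fun i i' => ∑ c ∈ I,
      ((b j : ℝ) * (if F i = c then 1 else 0) - if c / (b j : ℤ) = P i then 1 else 0) *
      ((b j : ℝ) * (if F i' = c then 1 else 0) - if c / (b j : ℤ) = P i' then 1 else 0) :=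
    ⟨I, inferInstance, fun c i => (b j : ℝ) * (if F i = c then 1 else 0) -
      if (c : ℤ) / (b j : ℤ) = P i then 1 else 0, fun i i' => by
        rw [Finset.sum_coe_sort I fun c =>
      ((b j : ℝ) * (if F i = c then 1 else 0) - if c / (b j : ℤ) = P i then 1 else 0) *
      ((b j : ℝ) * (if F i' = c then 1 else 0) - if c / (b j : ℤ) = P i' then 1 else 0)]⟩
  convert hgram.const_mul (inv_nonneg.2 hb0.le) using 3 with i i'
  have hcard : ∑ c ∈ I, (if c / (b j : ℤ) = P i then (1 : ℝ) else 0) = b j := by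
    rw [Finset.sum_boole, hI, pow_succ]
    obtain ⟨h0, h1⟩ := floor_pow_mul_mem hb hS j κ i
    exact congrArg Nat.cast (card_ediv_eq (hb j) h0 h1)
  have e1 : ∑ c ∈ I, (if F i = c then (1 : ℝ) else 0) * (if F i' = c then 1 else 0)
      = if F i = F i' then 1 else 0 := by
    simp [hFI, eq_comm]
  have e2 : ∑ c ∈ I, (if F i = c then (1 : ℝ) else 0) * (if c / (b j : ℤ) = P i' then 1 else 0)
      = if P i = P i' then 1 else 0 := by
    simp only [ite_mul, one_mul, zero_mul, Finset.sum_ite_eq, hFI, hFP, if_true]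
  have e3 : ∑ c ∈ I, (if c / (b j : ℤ) = P i then 1 else 0) * (if F i' = c then (1 : ℝ) else 0)
      = if P i = P i' then 1 else 0 := by
    simp [hFI, hFP, eq_comm]
  have e4 : ∑ c ∈ I, (if c / (b j : ℤ) = P i then 1 else 0) *
      (if c / (b j : ℤ) = P i' then (1 : ℝ) else 0) = b j * if P i = P i' then 1 else 0 := by
    by_cases h : P i = P i'
    · simp only [← h, if_true, mul_one]
      rw [← hcard]
      exact Finset.sum_congr rfl fun c _ => by split_ifs <;> simp
    · rw [if_neg h, mul_zero]
      refine Finset.sum_eq_zero fun c _ => ?_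
      split_ifs with h1 h2 <;> simp
      exact h (h1.symm.trans h2)
  have hsum : ∑ c ∈ I,
      ((b j : ℝ) * (if F i = c then 1 else 0) - if c / (b j : ℤ) = P i then 1 else 0) *
      ((b j : ℝ) * (if F i' = c then 1 else 0) - if c / (b j : ℤ) = P i' then 1 else 0)
      = (b j : ℝ) ^ 2 * (if F i = F i' then 1 else 0) - b j * if P i = P i' then 1 else 0 := by
    calc _ = (b j : ℝ) ^ 2 * (∑ c ∈ I, (if F i = c then (1 : ℝ) else 0) *
            (if F i' = c then 1 else 0))
          - b j * (∑ c ∈ I, (if F i = c then (1 : ℝ) else 0) *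
            (if c / (b j : ℤ) = P i' then 1 else 0))
          - b j * (∑ c ∈ I, (if c / (b j : ℤ) = P i then 1 else 0) *
            (if F i' = c then (1 : ℝ) else 0))
          + ∑ c ∈ I, (if c / (b j : ℤ) = P i then 1 else 0) *
            (if c / (b j : ℤ) = P i' then (1 : ℝ) else 0) := by
          simp only [Finset.mul_sum, ← Finset.sum_sub_distrib, ← Finset.sum_add_distrib]
          exact Finset.sum_congr rfl fun c _ => by ring
      _ = _ := by
          rw [e1, e2, e3, e4]
          ring
  rw [hsum]
  simp only [sameCell, hF, hP]
  field_simp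

theorem prod_sameCell (u : Finset (Fin d)) (κ : Fin d → ℕ) (i i' : ℕ) :
    ∏ j ∈ u, sameCell b S j (κ j) i i' =
      if ∀ j ∈ u, ⌊(b j : ℝ) ^ κ j * S i j⌋ = ⌊(b j : ℝ) ^ κ j * S i' j⌋ then 1 else 0 := by
  simp only [sameCell, Finset.prod_boole]
  congr

theorem IsEquidistributed.existsUnique_block (hS : IsEquidistributed b S) (hb : ∀ j, 1 ≤ b j)
    (u : Finset (Fin d)) (κ : Fin d → ℕ) (r i : ℕ) :
    ∃! i', i' ∈ Finset.Ico (r * ∏ j ∈ u, b j ^ κ j) ((r + 1) * ∏ j ∈ u, b j ^ κ j) ∧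
      ∀ j ∈ u, ⌊(b j : ℝ) ^ κ j * S i j⌋ = ⌊(b j : ℝ) ^ κ j * S i' j⌋ := by
  classical
  have h := hS.2 r (fun j => if j ∈ u then κ j else 0)
    (fun j => ⌊(b j : ℝ) ^ (if j ∈ u then κ j else 0) * S i j⌋)
    fun j => floor_pow_mul_mem hb hS.1 j _ i
  have hprod : ∏ j, b j ^ (if j ∈ u then κ j else 0) = ∏ j ∈ u, b j ^ κ j := by
    simp [pow_ite, Finset.prod_ite_mem]
  rw [hprod] at h
  refine (existsUnique_congr fun i' => and_congr_right fun _ => forall_congr' fun j => ?_).1 h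
  by_cases hj : j ∈ u
  · simp [hj, eq_comm]
  · have h0 : ∀ i, ⌊S i j⌋ = 0 := fun i => Int.floor_eq_zero_iff.2 (hS.1 i j)
    simp [hj, h0]

theorem sum_block_prod_sameCell (hS : IsEquidistributed b S) (hb : ∀ j, 1 ≤ b j)
    (u : Finset (Fin d)) (κ : Fin d → ℕ) (r i : ℕ) :
    ∑ i' ∈ Finset.Ico (r * ∏ j ∈ u, b j ^ κ j) ((r + 1) * ∏ j ∈ u, b j ^ κ j),
      ∏ j ∈ u, sameCell b S j (κ j) i i' = 1 := by
  obtain ⟨p, ⟨hp, hpc⟩, huniq⟩ := hS.existsUnique_block hb u κ r i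
  simp_rw [prod_sameCell]
  rw [Finset.sum_eq_single_of_mem p hp, if_pos hpc]
  intro q hq hqp
  rw [if_neg]
  exact fun h => hqp (huniq q ⟨hq, h⟩)

theorem sum_range_prod_sameCell (hS : IsEquidistributed b S) (hb : ∀ j, 1 ≤ b j)
    (u : Finset (Fin d)) (κ : Fin d → ℕ) (q i : ℕ) :
    ∑ i' ∈ range (q * ∏ j ∈ u, b j ^ κ j), ∏ j ∈ u, sameCell b S j (κ j) i i' = q := by
  induction q with
  | zero => simp
  | succ q ih =>
    rw [← Finset.sum_range_add_sum_Ico _ (Nat.mul_le_mul_right _ (Nat.le_succ q)), ih,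
      sum_block_prod_sameCell hS hb]
    push_cast
    rfl

theorem sameCell_nonneg (j : Fin d) (κ i i' : ℕ) : 0 ≤ sameCell b S j κ i i' := by
  unfold sameCell
  split_ifs <;> norm_num

theorem sameCell_succ_le (hb : ∀ j, 1 ≤ b j) (j : Fin d) (κ i i' : ℕ) :
    sameCell b S j (κ + 1) i i' ≤ sameCell b S j κ i i' := by
  unfold sameCell
  rw [← floor_pow_succ_ediv hb j κ i, ← floor_pow_succ_ediv hb j κ i']
  split_ifs with h1 h2 <;> simp_all

/-- Refining one coordinate by one digit costs at most `b jm - 1` per point. -/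
theorem sum_mul_prod_sameCell_sub_le (hS : IsEquidistributed b S) (hb : ∀ j, 1 ≤ b j)
    {u : Finset (Fin d)} {jm : Fin d} (hjm : jm ∈ u) (κ : Fin d → ℕ) (n i : ℕ) :
    ∑ i' ∈ range n, ((b jm : ℝ) * sameCell b S jm (κ jm + 1) i i' - sameCell b S jm (κ jm) i i') *
      ∏ j ∈ u.erase jm, sameCell b S j (κ j) i i' ≤ b jm - 1 := by
  classical
  set κ' : Fin d → ℕ := Function.update κ jm (κ jm + 1) with hκ'
  have hprod : ∀ i', sameCell b S jm (κ jm) i i' * ∏ j ∈ u.erase jm, sameCell b S j (κ j) i i' =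
      ∏ j ∈ u, sameCell b S j (κ j) i i' := fun i' =>
    Finset.mul_prod_erase u (fun j => sameCell b S j (κ j) i i') hjm
  have hprod' : ∀ i', sameCell b S jm (κ jm + 1) i i' *
      ∏ j ∈ u.erase jm, sameCell b S j (κ j) i i' = ∏ j ∈ u, sameCell b S j (κ' j) i i' := by
    intro i'
    rw [← Finset.mul_prod_erase u (fun j => sameCell b S j (κ' j) i i') hjm]
    congr 1
    · simp [hκ']
    · refine Finset.prod_congr rfl fun j hj => ?_
      rw [hκ', Function.update_of_ne (Finset.ne_of_mem_erase hj)]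
  set M := ∏ j ∈ u, b j ^ κ j with hM
  have hM' : ∏ j ∈ u, b j ^ κ' j = b jm * M := by
    rw [hM, ← Finset.mul_prod_erase u (fun j => b j ^ κ j) hjm,
      ← Finset.mul_prod_erase u (fun j => b j ^ κ' j) hjm, ← mul_assoc]
    congr 1
    · simp [hκ', pow_succ, mul_comm]
    · refine Finset.prod_congr rfl fun j hj => ?_
      rw [hκ', Function.update_of_ne (Finset.ne_of_mem_erase hj)]
  have hMpos : 0 < b jm * M := Nat.mul_pos (hb jm) (Finset.prod_pos fun j _ => pow_pos (hb j) _)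
  set q := n / (b jm * M) with hq
  have hqn : q * (b jm * M) ≤ n := Nat.div_mul_le_self _ _
  have hnq : n ≤ (q + 1) * (b jm * M) := by
    rw [Nat.add_mul, one_mul]
    exact (Nat.lt_div_mul_add hMpos).le
  have hfine := sum_range_prod_sameCell hS hb u κ' q i
  have hcoarse := sum_range_prod_sameCell hS hb u κ (q * b jm) i
  have hblock := sum_block_prod_sameCell hS hb u κ' q i
  rw [hM'] at hfine hblock
  rw [← hM, mul_assoc] at hcoarse
  have hnonneg : ∀ i', 0 ≤ ∏ j ∈ u, sameCell b S j (κ' j) i i' := fun i' =>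
    Finset.prod_nonneg fun j _ => sameCell_nonneg j _ i i'
  have htail : ∑ i' ∈ Finset.Ico (q * (b jm * M)) n, ∏ j ∈ u, sameCell b S j (κ' j) i i' ≤ 1 := by
    rw [← hblock]
    exact Finset.sum_le_sum_of_subset_of_nonneg (Finset.Ico_subset_Ico_right hnq)
      fun i' _ _ => hnonneg i'
  have hmono : ∑ i' ∈ Finset.Ico (q * (b jm * M)) n, ∏ j ∈ u, sameCell b S j (κ' j) i i' ≤
      ∑ i' ∈ Finset.Ico (q * (b jm * M)) n, ∏ j ∈ u, sameCell b S j (κ j) i i' := by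
    refine Finset.sum_le_sum fun i' _ => ?_
    rw [← hprod, ← hprod']
    exact mul_le_mul_of_nonneg_right (sameCell_succ_le hb _ _ _ _)
      (Finset.prod_nonneg fun j _ => sameCell_nonneg j _ i i')
  have hb1 : (1 : ℝ) ≤ b jm := by exact_mod_cast hb jm
  simp_rw [sub_mul, mul_assoc, hprod, hprod']
  rw [Finset.sum_sub_distrib, ← Finset.mul_sum, ← Finset.sum_range_add_sum_Ico _ hqn,
    ← Finset.sum_range_add_sum_Ico _ hqn, hfine, hcoarse]
  push_cast
  nlinarith

theorem gain_eq_sum_sameCell (u : Finset (Fin d)) (k : Fin d → ℕ) (n : ℕ) :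
    gain b S u k n = (∏ j ∈ u, ((b j : ℝ) - 1)⁻¹) * (n : ℝ)⁻¹ *
      ∑ i ∈ range n, ∑ i' ∈ range n,
        ∏ j ∈ u, ((b j : ℝ) * sameCell b S j (k j + 1) i i' - sameCell b S j (k j) i i') :=
  rfl

theorem gain_le (hS : IsEquidistributed b S) (hb : ∀ j, 2 ≤ b j) {u : Finset (Fin d)}
    {jm : Fin d} (hjm : jm ∈ u) (k : Fin d → ℕ) {n : ℕ} (hn : 1 ≤ n) :
    gain b S u k n ≤ ∏ j ∈ u.erase jm, (b j : ℝ) / ((b j : ℝ) - 1) := by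
  classical
  have hb1 : ∀ j, 1 ≤ b j := fun j => (hb j).trans' one_le_two
  have hpos : ∀ j, (0 : ℝ) < (b j : ℝ) - 1 := fun j => by
    have : (2 : ℝ) ≤ b j := by exact_mod_cast hb j
    linarith
  have hn0 : (0 : ℝ) < n := by exact_mod_cast hn
  set K : Fin d → ℕ → ℕ → ℝ := fun j i i' =>
    (b j : ℝ) * sameCell b S j (k j + 1) i i' - sameCell b S j (k j) i i' with hK
  have hKg : ∀ j, IsGramKernel (K j) := fun j => isGramKernel_mul_sameCell_sub hb1 hS.1 j (k j)
  have hdiff := (hKg jm).mul (IsGramKernel.prod_sub_prod (u.erase jm) (P := K)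
    (Q := fun j i i' => (b j : ℝ) * sameCell b S j (k j + 1) i i') (fun j _ => hKg j) fun j _ => by
      simpa [hK] using isGramKernel_sameCell hb1 hS.1 j (k j))
  have h0 := hdiff.sum_nonneg n
  have hprod : ∀ i i', K jm i i' * ∏ j ∈ u.erase jm, K j i i' = ∏ j ∈ u, K j i i' :=
    fun i i' => Finset.mul_prod_erase u (fun j => K j i i') hjm
  simp_rw [mul_sub, hprod, Finset.sum_sub_distrib] at h0
  have hupper : ∑ i ∈ range n, ∑ i' ∈ range n, K jm i i' *
      ∏ j ∈ u.erase jm, ((b j : ℝ) * sameCell b S j (k j + 1) i i') ≤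
      (∏ j ∈ u.erase jm, (b j : ℝ)) * (n * (b jm - 1)) := by
    have hrow : ∀ i ∈ range n, ∑ i' ∈ range n, K jm i i' *
        ∏ j ∈ u.erase jm, sameCell b S j (k j + 1) i i' ≤ b jm - 1 := by
      intro i _
      have h := sum_mul_prod_sameCell_sub_le hS hb1 hjm
        (Function.update (fun j => k j + 1) jm (k jm)) n i
      simp only [Function.update_self] at h
      refine h.trans_eq' (Finset.sum_congr rfl fun i' _ => ?_)
      congr 1
      exact Finset.prod_congr rfl fun j hj => by
        rw [Function.update_of_ne (Finset.ne_of_mem_erase hj)]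
    have hsum := Finset.sum_le_sum hrow
    simp only [Finset.sum_const, Finset.card_range, nsmul_eq_mul] at hsum
    simp_rw [Finset.prod_mul_distrib, mul_left_comm (K jm _ _), ← Finset.mul_sum]
    exact mul_le_mul_of_nonneg_left hsum (Finset.prod_nonneg fun j _ => Nat.cast_nonneg _)
  have hle : ∑ i ∈ range n, ∑ i' ∈ range n, ∏ j ∈ u, K j i i' ≤
      (∏ j ∈ u.erase jm, (b j : ℝ)) * (n * (b jm - 1)) := by linarith
  have hinv : (0 : ℝ) ≤ (∏ j ∈ u, ((b j : ℝ) - 1)⁻¹) * (n : ℝ)⁻¹ :=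
    mul_nonneg (Finset.prod_nonneg fun j _ => inv_nonneg.2 (hpos j).le) (inv_nonneg.2 hn0.le)
  rw [gain_eq_sum_sameCell]
  refine (mul_le_mul_of_nonneg_left hle hinv).trans_eq ?_
  rw [← Finset.mul_prod_erase u _ hjm]
  simp_rw [div_eq_mul_inv, Finset.prod_mul_distrib]
  have := (hpos jm).ne'
  field_simp

theorem gain_eq_zero (hS : IsEquidistributed b S) (hb : ∀ j, 1 ≤ b j) {u : Finset (Fin d)}
    (hu : u.Nonempty) (k : Fin d → ℕ) {n : ℕ} (hn : ∏ j ∈ u, b j ^ (k j + 1) ∣ n) :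
    gain b S u k n = 0 := by
  classical
  have hb0 : ∀ j, (b j : ℝ) ≠ 0 := fun j => by
    have := hb j
    positivity
  rw [gain_eq_sum_sameCell, Finset.sum_eq_zero, mul_zero]
  intro i _
  have hcount : ∀ t ∈ u.powerset, ∑ i' ∈ range n,
      (∏ j ∈ t, sameCell b S j (k j) i i') * ∏ j ∈ u \ t, sameCell b S j (k j + 1) i i' =
      n * ((∏ j ∈ t, ((b j : ℝ) ^ k j)⁻¹) * ∏ j ∈ u \ t, ((b j : ℝ) ^ (k j + 1))⁻¹) := by
    intro t ht
    have ht := Finset.mem_powerset.1 ht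
    set κ : Fin d → ℕ := fun j => if j ∈ t then k j else k j + 1 with hκ
    have hsplit : ∀ {R : Type} [CommMonoid R] (f : Fin d → ℕ → R), ∏ j ∈ u, f j (κ j) =
        (∏ j ∈ t, f j (k j)) * ∏ j ∈ u \ t, f j (k j + 1) := by
      intro R _ f
      rw [← Finset.prod_sdiff ht, mul_comm]
      congr 1
      · exact Finset.prod_congr rfl fun j hj => by simp [hκ, hj]
      · exact Finset.prod_congr rfl fun j hj => by simp [hκ, (Finset.mem_sdiff.1 hj).2]
    have hdvd : ∏ j ∈ u, b j ^ κ j ∣ n := by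
      refine (Finset.prod_dvd_prod_of_dvd _ _ fun j _ => pow_dvd_pow _ ?_).trans hn
      simp only [hκ]
      split_ifs <;> omega
    obtain ⟨q, rfl⟩ := hdvd
    rw [← hsplit fun j κ => ((b j : ℝ) ^ κ)⁻¹, mul_comm _ q]
    rw [Finset.sum_congr rfl fun i' _ => (hsplit fun j κ => sameCell b S j κ i i').symm,
      sum_range_prod_sameCell hS hb]
    push_cast
    rw [mul_assoc, ← Finset.prod_mul_distrib, Finset.prod_eq_one, mul_one]
    exact fun j _ => mul_inv_cancel₀ (pow_ne_zero _ (hb0 j))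
  simp_rw [Finset.prod_sub]
  rw [Finset.sum_comm]
  have hfold : ∀ t ∈ u.powerset, ∑ i' ∈ range n, (-1 : ℝ) ^ #t *
      (∏ j ∈ u \ t, (b j : ℝ) * sameCell b S j (k j + 1) i i') *
        ∏ j ∈ t, sameCell b S j (k j) i i' =
      n * ((-1) ^ #t * (∏ j ∈ u \ t, (b j : ℝ) * ((b j : ℝ) ^ (k j + 1))⁻¹) *
        ∏ j ∈ t, ((b j : ℝ) ^ k j)⁻¹) := by
    intro t ht
    simp_rw [Finset.prod_mul_distrib]
    have h := congrArg (fun x => (-1 : ℝ) ^ #t * (∏ j ∈ u \ t, (b j : ℝ)) * x) (hcount t ht)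
    simp only [Finset.mul_sum] at h
    refine (Finset.sum_congr rfl fun i' _ => ?_).trans (h.trans ?_) <;> ring
  rw [Finset.sum_congr rfl hfold, ← Finset.mul_sum,
    ← Finset.prod_sub (fun j => (b j : ℝ) * ((b j : ℝ) ^ (k j + 1))⁻¹)]
  obtain ⟨j, hj⟩ := hu
  rw [Finset.prod_eq_zero hj, mul_zero]
  have := hb0 j
  field_simp
  ring

theorem gain_eq_one (hS : IsEquidistributed b S) (hb : ∀ j, 2 ≤ b j) (u : Finset (Fin d))
    (k : Fin d → ℕ) {n : ℕ} (hn : 1 ≤ n) (hnM : n ≤ ∏ j ∈ u, b j ^ k j) :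
    gain b S u k n = 1 := by
  have hb1 : ∀ j, 1 ≤ b j := fun j => (hb j).trans' one_le_two
  have hpos : ∀ j, (0 : ℝ) < (b j : ℝ) - 1 := fun j => by
    have : (2 : ℝ) ≤ b j := by exact_mod_cast hb j
    linarith
  have hn0 : (n : ℝ) ≠ 0 := by positivity
  have hrow : ∀ i ∈ range n, ∑ i' ∈ range n,
      ∏ j ∈ u, ((b j : ℝ) * sameCell b S j (k j + 1) i i' - sameCell b S j (k j) i i') =
      ∏ j ∈ u, ((b j : ℝ) - 1) := by
    intro i hi
    rw [Finset.sum_eq_single_of_mem i hi]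
    · simp [sameCell]
    · intro i' hi' hne
      have hmem : ∀ p ∈ range n,
          p ∈ Finset.Ico (0 * ∏ j ∈ u, b j ^ k j) ((0 + 1) * ∏ j ∈ u, b j ^ k j) := fun p hp => by
        simpa using (Finset.mem_range.1 hp).trans_le hnM
      have : ¬ ∀ j ∈ u, ⌊(b j : ℝ) ^ k j * S i j⌋ = ⌊(b j : ℝ) ^ k j * S i' j⌋ := fun h =>
        hne ((hS.existsUnique_block hb1 u k 0 i).unique ⟨hmem i' hi', h⟩
          ⟨hmem i hi, fun _ _ => rfl⟩)
      push Not at this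
      obtain ⟨j, hj, hjne⟩ := this
      have hz : sameCell b S j (k j) i i' = 0 := if_neg hjne
      have hz' : sameCell b S j (k j + 1) i i' = 0 :=
        le_antisymm ((sameCell_succ_le hb1 j _ i i').trans_eq hz) (sameCell_nonneg j _ i i')
      exact Finset.prod_eq_zero hj (by rw [hz, hz']; ring)
  rw [gain_eq_sum_sameCell, Finset.sum_congr rfl hrow, Finset.prod_inv_distrib]
  have : ∏ j ∈ u, ((b j : ℝ) - 1) ≠ 0 := Finset.prod_ne_zero_iff.2 fun j _ => (hpos j).ne'
  simp only [Finset.sum_const, Finset.card_range, nsmul_eq_mul]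
  field_simp

end


theorem statement9 {d : ℕ} (hd : 1 ≤ d) (b : ℕ) (hb : 2 ≤ b)
    (e : Fin d → ℕ) (he : ∀ j, 1 ≤ e j)
    (S : ℕ → Fin d → ℝ) (hS : IsEquidistributed (fun j => b ^ e j) S)
    (u : Finset (Fin d)) (hu : u.Nonempty)
    (jm : Fin d) (hjm : jm ∈ u) (hmin : ∀ j ∈ u, e jm ≤ e j)
    (k : Fin d → ℕ) :
    (∀ n : ℕ, 1 ≤ n →
        gain (fun j => b ^ e j) S u k n ≤
          ∏ j ∈ u.erase jm, (b : ℝ) ^ e j / ((b : ℝ) ^ e j - 1)) ∧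
    (∀ m : ℕ, (∑ j ∈ u, e j * (k j + 1)) ≤ m →
        gain (fun j => b ^ e j) S u k (b ^ m) = 0) ∧
    (∀ m : ℕ, 1 ≤ m → m ≤ ∑ j ∈ u, e j * k j →
        gain (fun j => b ^ e j) S u k (b ^ m) = 1) := by
  have hb2 : ∀ j, 2 ≤ b ^ e j := fun j => hb.trans (Nat.le_self_pow (by have := he j; omega) b)
  have hb1 : ∀ j, 1 ≤ b ^ e j := fun j => (hb2 j).trans' one_le_two
  refine ⟨fun n hn => ?_, fun m hm => ?_, fun m _ hm => ?_⟩
  · simpa using gain_le hS hb2 hjm k hn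
  · refine gain_eq_zero hS hb1 hu k ?_
    simp_rw [← pow_mul, Finset.prod_pow_eq_pow_sum]
    exact pow_dvd_pow _ hm
  · refine gain_eq_one hS hb2 u k (Nat.one_le_pow _ _ (by omega)) ?_
    simp_rw [← pow_mul, Finset.prod_pow_eq_pow_sum]
    exact Nat.pow_le_pow_right (by omega) hm

end
end

section
/- Let b ≥ 2 be an integer, e_1,…,e_d ∈ ℕ, and let S be an equidistributed sequence in base (b^{e_1},…,b^{e_d}); write G_{u,k}(n) for the gain coefficient of its first n points in this base. Fix a nonempty u ⊆ {1,…,d}, let j_m ∈ u minimize e_j over j ∈ u, and set Γ_u := ∏_{j∈u∖{j_m}} b^{e_j}/(b^{e_j}−1) (empty product = 1). Then for every k ∈ ℕ_0^{|u|}, the supremum over n ∈ ℕ of G_{u,k}(n) is attained and equals Γ_u: max_{n∈ℕ} G_{u,k}(n) = Γ_u. -/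
open Finset MeasureTheory

noncomputable section


/-- `s * (m - s)`, where `s` is the residue of `n` modulo `m`. -/
def residueForm (n m : ℕ) : ℝ := ((n % m : ℕ) : ℝ) * ((m : ℝ) - ((n % m : ℕ) : ℝ))

/-- The alternating sum of `F (M * ∏ j ∈ v, q j)` over the subsets `v` of `u`. -/
def altSum {d : ℕ} (q : Fin d → ℕ) (F : ℕ → ℝ) (u : Finset (Fin d)) (M : ℕ) : ℝ :=
  ∑ v ∈ u.powerset, (-1 : ℝ) ^ #(u \ v) * F (M * ∏ j ∈ v, q j)

lemma altSum_empty {d : ℕ} (q : Fin d → ℕ) (F : ℕ → ℝ) (M : ℕ) : altSum q F ∅ M = F M := by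
  simp [altSum]

lemma altSum_insert {d : ℕ} (q : Fin d → ℕ) (F : ℕ → ℝ) {u : Finset (Fin d)} {a : Fin d}
    (ha : a ∉ u) (M : ℕ) :
    altSum q F (insert a u) M = altSum q F u (M * q a) - altSum q F u M := by
  unfold altSum
  rw [Finset.sum_powerset_insert ha, add_comm, sub_eq_add_neg, ← Finset.sum_neg_distrib]
  congr 1
  · refine Finset.sum_congr rfl fun v hv => ?_
    have hav : a ∉ v := fun h => ha (Finset.mem_powerset.1 hv h)
    have hs : insert a u \ insert a v = u \ v := by
      ext x; simp only [mem_sdiff, mem_insert]; grind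
    rw [hs, Finset.prod_insert hav, mul_assoc]
  · refine Finset.sum_congr rfl fun v hv => ?_
    have hav : a ∉ v := fun h => ha (Finset.mem_powerset.1 hv h)
    rw [Finset.insert_sdiff_of_notMem _ hav, Finset.card_insert_of_notMem (by simp [ha])]
    ring

lemma altSum_const {d : ℕ} (q : Fin d → ℕ) (c : ℝ) {u : Finset (Fin d)} (hu : u.Nonempty)
    (M : ℕ) : altSum q (fun _ => c) u M = 0 := by
  obtain ⟨a, ha⟩ := hu
  rw [← Finset.insert_erase ha, altSum_insert q _ (Finset.notMem_erase a u)]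
  simp [altSum]

/-- Between consecutive multiples of `M`, `residueForm · (M * p)` is the chord of its end values
plus a term that does not depend on `p`. -/
lemma residueForm_mul (M p t r : ℕ) (hp : 1 ≤ p) (hr : r < M) :
    residueForm (M * t + r) (M * p) =
      (M : ℝ) * (M - r) * residueForm t p + M * r * residueForm (t + 1) p + r * (M - r) := by
  have hM : 0 < M := by omega
  have h1 : (M * t + r) % (M * p) = M * (t % p) + r := by
    rw [Nat.mod_mul, Nat.mul_add_mod, Nat.mod_eq_of_lt hr, Nat.mul_add_div hM,
      Nat.div_eq_of_lt hr]
    simp [add_comm]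
  have hlt : t % p < p := Nat.mod_lt _ hp
  unfold residueForm
  rw [h1]
  rcases Nat.lt_or_ge (t % p + 1) p with h | h
  · have h2 : (t + 1) % p = t % p + 1 := by
      rw [← Nat.mod_add_mod, Nat.mod_eq_of_lt h]
    rw [h2]; push_cast; ring
  · have h3 : p = t % p + 1 := by omega
    have h2 : (t + 1) % p = 0 := by
      rw [← Nat.mod_add_mod, ← h3, Nat.mod_self]
    have h4 : (p : ℝ) = ((t % p : ℕ) : ℝ) + 1 := by exact_mod_cast h3
    rw [h2]; push_cast; rw [h4]; ring

lemma altSum_residueForm_interpolate {d : ℕ} (q : Fin d → ℕ) (hq : ∀ j, 1 ≤ q j)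
    {u : Finset (Fin d)} (hu : u.Nonempty) {M t r : ℕ} (hr : r < M) :
    altSum q (residueForm (M * t + r)) u M =
      (M : ℝ) * (M - r) * altSum q (residueForm t) u 1 +
        M * r * altSum q (residueForm (t + 1)) u 1 := by
  rw [← add_zero (_ + _ : ℝ), ← altSum_const q ((r : ℝ) * (M - r)) hu 1]
  unfold altSum
  rw [Finset.mul_sum, Finset.mul_sum, ← Finset.sum_add_distrib, ← Finset.sum_add_distrib]
  refine Finset.sum_congr rfl fun v _ => ?_
  rw [residueForm_mul M _ t r (Finset.one_le_prod' fun j _ => hq j) hr, one_mul]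
  ring

lemma altSum_residueForm_nonneg {d : ℕ} (q : Fin d → ℕ) (hq : ∀ j, 1 ≤ q j)
    {u : Finset (Fin d)} (hu : u.Nonempty)
    (h : ∀ t, 0 ≤ altSum q (residueForm t) u 1) {M : ℕ} (hM : 1 ≤ M) (n : ℕ) :
    0 ≤ altSum q (residueForm n) u M := by
  have hr : n % M < M := Nat.mod_lt _ hM
  have hr' : ((n % M : ℕ) : ℝ) ≤ M := by exact_mod_cast hr.le
  have key := altSum_residueForm_interpolate q hq hu (t := n / M) hr
  rw [Nat.div_add_mod] at key
  rw [key]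
  have := h (n / M)
  have := h (n / M + 1)
  have : (0 : ℝ) ≤ M - (n % M : ℕ) := by linarith
  positivity

lemma residueForm_mul_sub_le (n m q : ℕ) (hm : 1 ≤ m) (hq : 1 ≤ q) :
    residueForm n (m * q) - residueForm n m ≤ m * ((q : ℝ) - 1) * n := by
  have h1 : n % (m * q) = n % m + m * (n / m % q) := Nat.mod_mul
  have h2 : m * (n / m % q) + n % m ≤ n := by
    rw [add_comm, ← h1]; exact Nat.mod_le _ _
  have hlt : n / m % q < q := Nat.mod_lt _ hq
  have hlt' : n % m < m := Nat.mod_lt _ hm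
  unfold residueForm
  rw [h1]
  push_cast
  generalize n / m % q = c at *
  generalize n % m = s at *
  have h2' : (m : ℝ) * c + s ≤ n := by exact_mod_cast h2
  have h3 : (c : ℝ) + 1 ≤ q := by exact_mod_cast hlt
  have h4 : (s : ℝ) + 1 ≤ m := by exact_mod_cast hlt'
  have hq1 : (0 : ℝ) ≤ q - 1 := by have := Nat.cast_nonneg (α := ℝ) c; linarith
  have e1 : (m : ℝ) * (q - 1) * (m * c + s) ≤ m * (q - 1) * n := by gcongr
  refine le_trans ?_ e1
  have hcc : (c : ℝ) ≤ c * c := by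
    rcases Nat.eq_zero_or_pos c with rfl | hc
    · simp
    · have : (1 : ℝ) ≤ c := by exact_mod_cast hc
      nlinarith
  have e2 : 0 ≤ (m : ℝ) * m * (c * c - c) :=
    mul_nonneg (by positivity) (by linarith)
  have e3 : 0 ≤ (m : ℝ) * c * s := by positivity
  nlinarith

lemma altSum_residueForm_le {d : ℕ} (q : Fin d → ℕ) (hq : ∀ j, 1 ≤ q j) (a : Fin d) (n : ℕ)
    (h : ∀ u : Finset (Fin d), u.Nonempty → ∀ t, 0 ≤ altSum q (residueForm t) u 1)
    (w : Finset (Fin d)) (haw : a ∉ w) :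
    ∀ M : ℕ, 1 ≤ M → altSum q (residueForm n) (insert a w) M ≤
      ((M * ∏ j ∈ w, q j : ℕ) : ℝ) * ((q a : ℝ) - 1) * n := by
  induction w using Finset.induction_on with
  | empty =>
    intro M hM
    rw [altSum_insert q _ (Finset.notMem_empty a), altSum_empty, altSum_empty]
    simpa using residueForm_mul_sub_le n M (q a) hM (hq a)
  | insert c w hc ih =>
    intro M hM
    have hac : c ≠ a := by rintro rfl; simp at haw
    have haw' : a ∉ w := fun h => haw (Finset.mem_insert_of_mem h)
    have hcw : c ∉ insert a w := by simp [hac, hc]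
    rw [Finset.insert_comm, altSum_insert q _ hcw, Finset.prod_insert hc, ← mul_assoc]
    have h1 := ih haw' (M * q c) (Nat.mul_pos hM (hq c))
    have h2 := altSum_residueForm_nonneg q hq (Finset.insert_nonempty a w)
      (h _ (Finset.insert_nonempty a w)) hM n
    linarith

/-- If every aligned block of `m = #A` indices meets each class in `A` exactly once, the number
of pairs of equal class among the first `n` indices depends on `n` and `m` only. -/
lemma sum_ite_eq_of_block_bijective {α : Type*} [DecidableEq α] (A : Finset α) (c : ℕ → α)
    (hc : ∀ i, c i ∈ A) (hA : 1 ≤ #A)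
    (h : ∀ r, ∀ a ∈ A, ∃! i, i ∈ Finset.Ico (r * #A) ((r + 1) * #A) ∧ c i = a) (n : ℕ) :
    (#A : ℝ) * ∑ i ∈ Finset.range n, ∑ i' ∈ Finset.range n, (if c i = c i' then (1 : ℝ) else 0) =
      (n : ℝ) ^ 2 + residueForm n #A := by
  set m := #A with hm
  let N : α → ℕ := fun a => #{i ∈ Finset.range n | c i = a}
  have hblock : ∀ r, ∀ a ∈ A, #{i ∈ Finset.range (r * m) | c i = a} = r := by
    intro r a ha
    induction r with
    | zero => simp
    | succ r ih =>
      have hsplit : Finset.range ((r + 1) * m) =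
          Finset.range (r * m) ∪ Finset.Ico (r * m) ((r + 1) * m) := by
        ext x; simp only [Finset.mem_union, Finset.mem_range, Finset.mem_Ico]
        have : r * m ≤ (r + 1) * m := Nat.mul_le_mul_right _ (by omega)
        omega
      rw [hsplit, Finset.filter_union, Finset.card_union_of_disjoint, ih]
      · congr 1
        obtain ⟨i, hi, hu⟩ := h r a ha
        rw [Finset.card_eq_one]
        refine ⟨i, ?_⟩
        ext x
        simp only [Finset.mem_filter, Finset.mem_singleton]
        exact ⟨fun hx => hu x hx, fun hx => hx ▸ hi⟩
      · refine Finset.disjoint_filter_filter ?_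
        rw [Finset.disjoint_left]
        intro x hx hx'
        simp only [Finset.mem_range, Finset.mem_Ico] at hx hx'
        omega
  set r := n / m with hr
  have hdm : m * r + n % m = n := Nat.div_add_mod n m
  have hmod : n % m < m := Nat.mod_lt _ hA
  have hlow : ∀ a ∈ A, r ≤ N a := by
    intro a ha
    rw [← hblock r a ha]
    refine Finset.card_le_card (Finset.filter_subset_filter _ ?_)
    exact Finset.range_subset_range.2 (by rw [mul_comm]; omega)
  have hup : ∀ a ∈ A, N a ≤ r + 1 := by
    intro a ha
    rw [← hblock (r + 1) a ha]
    refine Finset.card_le_card (Finset.filter_subset_filter _ ?_)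
    exact Finset.range_subset_range.2 (by rw [mul_comm, mul_add, mul_one]; omega)
  have hsum : ∑ a ∈ A, (N a : ℝ) = n := by
    have := Finset.card_eq_sum_card_fiberwise (f := c) (s := Finset.range n) (t := A)
      (fun i _ => hc i)
    rw [Finset.card_range] at this
    exact_mod_cast this.symm
  have hsq : ∑ i ∈ Finset.range n, ∑ i' ∈ Finset.range n, (if c i = c i' then (1 : ℝ) else 0) =
      ∑ a ∈ A, (N a : ℝ) ^ 2 := by
    have h1 : ∀ i ∈ Finset.range n,
        ∑ i' ∈ Finset.range n, (if c i = c i' then (1 : ℝ) else 0) = N (c i) := by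
      intro i _
      rw [Finset.sum_boole]
      simp only [N, eq_comm]
    rw [Finset.sum_congr rfl h1,
      ← Finset.sum_fiberwise_of_maps_to (t := A) (g := c) (fun i _ => hc i)]
    refine Finset.sum_congr rfl fun a _ => ?_
    rw [Finset.sum_congr rfl (g := fun _ => (N a : ℝ))]
    · rw [Finset.sum_const, nsmul_eq_mul, sq]
    · intro i hi
      rw [(Finset.mem_filter.1 hi).2]
  have hsq' : ∑ a ∈ A, (N a : ℝ) ^ 2 = (2 * r + 1) * n - r * (r + 1) * m := by
    rw [← hsum, Finset.mul_sum, hm, mul_comm _ ((#A : ℕ) : ℝ), ← nsmul_eq_mul,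
      ← Finset.sum_const, ← Finset.sum_sub_distrib]
    refine Finset.sum_congr rfl fun a ha => ?_
    have h1 := hlow a ha
    have h2 := hup a ha
    rcases (by omega : N a = r ∨ N a = r + 1) with h | h <;> rw [h] <;> push_cast <;> ring
  rw [hsq, hsq']
  unfold residueForm
  have hdm' : (n : ℝ) = m * r + (n % m : ℕ) := by exact_mod_cast hdm.symm
  generalize n % m = s at *
  rw [hdm']
  ring

lemma IsEquidistributed.sum_ite_eq {d : ℕ} {q : Fin d → ℕ} {S : ℕ → Fin d → ℝ}
    (hq : ∀ j, 1 ≤ q j) (hS : IsEquidistributed q S) (l : Fin d → ℕ) (n : ℕ) :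
    ((∏ j, q j ^ l j : ℕ) : ℝ) * ∑ i ∈ Finset.range n, ∑ i' ∈ Finset.range n,
      (if ∀ j, ⌊(q j : ℝ) ^ l j * S i j⌋ = ⌊(q j : ℝ) ^ l j * S i' j⌋ then (1 : ℝ) else 0) =
      (n : ℝ) ^ 2 + residueForm n (∏ j, q j ^ l j) := by
  let A : Finset (Fin d → ℤ) := Fintype.piFinset fun j => Finset.Ico 0 ((q j : ℤ) ^ l j)
  let c : ℕ → Fin d → ℤ := fun i j => ⌊(q j : ℝ) ^ l j * S i j⌋
  have hA : #A = ∏ j, q j ^ l j := by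
    rw [Fintype.card_piFinset]
    refine Finset.prod_congr rfl fun j _ => ?_
    rw [Int.card_Ico, sub_zero, ← Nat.cast_pow, Int.toNat_natCast]
  have hc : ∀ i, c i ∈ A := by
    intro i
    simp only [A, c, Fintype.mem_piFinset, Finset.mem_Ico]
    intro j
    obtain ⟨h0, h1⟩ := hS.1 i j
    have hpos : (0 : ℝ) < (q j : ℝ) ^ l j := pow_pos (by exact_mod_cast hq j) _
    refine ⟨Int.floor_nonneg.2 (by positivity), Int.floor_lt.2 ?_⟩
    push_cast
    nlinarith
  have hA1 : 1 ≤ #A := by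
    rw [hA]; exact Finset.one_le_prod' fun j _ => Nat.one_le_pow _ _ (hq j)
  have key := sum_ite_eq_of_block_bijective A c hc hA1 (fun r a ha => by
    have := hS.2 r l a (fun j => by
      simpa [A] using (Fintype.mem_piFinset.1 ha) j)
    simpa only [hA, c, funext_iff] using this) n
  rw [hA] at key
  simpa only [c, funext_iff] using key

lemma IsEquidistributed.gain_eq {d : ℕ} {q : Fin d → ℕ} {S : ℕ → Fin d → ℝ}
    (hq : ∀ j, 1 ≤ q j) (hS : IsEquidistributed q S) {u : Finset (Fin d)} (hu : u.Nonempty)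
    (k : Fin d → ℕ) (n : ℕ) :
    gain q S u k n = (∏ j ∈ u, ((q j : ℝ) - 1)⁻¹) * (n : ℝ)⁻¹ *
      (((∏ j ∈ u, q j ^ k j : ℕ) : ℝ)⁻¹ *
        altSum q (residueForm n) u (∏ j ∈ u, q j ^ k j)) := by
  unfold gain
  congr 1
  set M := ∏ j ∈ u, q j ^ k j with hM
  have hM0 : (M : ℝ) ≠ 0 := by
    have : 0 < M := Finset.prod_pos fun j _ => pow_pos (hq j) _
    positivity
  have hshift : altSum q (residueForm n) u M =
      altSum q (fun m => (n : ℝ) ^ 2 + residueForm n m) u M := by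
    rw [← zero_add (altSum q (residueForm n) u M), ← altSum_const q ((n : ℝ) ^ 2) hu M]
    unfold altSum
    simp only [mul_add, Finset.sum_add_distrib]
  rw [hshift]
  unfold altSum
  rw [Finset.mul_sum]
  simp_rw [sub_eq_add_neg (G := ℝ), Finset.prod_add]
  simp_rw [Finset.sum_comm (s := Finset.range n) (t := u.powerset)]
  refine Finset.sum_congr rfl fun v hv => ?_
  rw [Finset.mem_powerset] at hv
  let l : Fin d → ℕ := fun j => if j ∈ v then k j + 1 else if j ∈ u then k j else 0
  have hl : ∏ j, q j ^ l j = M * ∏ j ∈ v, q j := by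
    rw [hM, ← Finset.prod_subset (Finset.subset_univ u)
      (fun j _ hj => by simp [l, hj, Finset.notMem_mono hv hj]),
      ← Finset.prod_sdiff hv, ← Finset.prod_sdiff hv, mul_assoc, ← Finset.prod_mul_distrib]
    congr 1
    · refine Finset.prod_congr rfl fun j hj => ?_
      rw [Finset.mem_sdiff] at hj
      simp [l, hj.1, hj.2]
    · refine Finset.prod_congr rfl fun j hj => ?_
      simp [l, hj, pow_succ]
  have hP : (∏ j ∈ v, (q j : ℝ)) ≠ 0 :=
    Finset.prod_ne_zero_iff.2 fun j _ => by have := hq j; positivity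
  have hcount := hS.sum_ite_eq hq l n
  rw [hl] at hcount
  have hterm : ∀ i i', (∏ j ∈ v, ((q j : ℝ) *
        (if ⌊(q j : ℝ) ^ (k j + 1) * S i j⌋ = ⌊(q j : ℝ) ^ (k j + 1) * S i' j⌋
          then 1 else 0))) * ∏ j ∈ u \ v,
        -(if ⌊(q j : ℝ) ^ k j * S i j⌋ = ⌊(q j : ℝ) ^ k j * S i' j⌋ then (1 : ℝ) else 0) =
      ((∏ j ∈ v, (q j : ℝ)) * (-1 : ℝ) ^ #(u \ v)) *
        (if ∀ j, ⌊(q j : ℝ) ^ l j * S i j⌋ = ⌊(q j : ℝ) ^ l j * S i' j⌋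
          then (1 : ℝ) else 0) := by
    intro i i'
    have hiff : (∀ j, ⌊(q j : ℝ) ^ l j * S i j⌋ = ⌊(q j : ℝ) ^ l j * S i' j⌋) ↔
        (∀ j ∈ v, ⌊(q j : ℝ) ^ (k j + 1) * S i j⌋ = ⌊(q j : ℝ) ^ (k j + 1) * S i' j⌋) ∧
        ∀ j ∈ u \ v, ⌊(q j : ℝ) ^ k j * S i j⌋ = ⌊(q j : ℝ) ^ k j * S i' j⌋ := by
      constructor
      · intro h
        refine ⟨fun j hj => ?_, fun j hj => ?_⟩
        · simpa [l, hj] using h j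
        · rw [Finset.mem_sdiff] at hj
          simpa [l, hj.1, hj.2] using h j
      · rintro ⟨h1, h2⟩ j
        by_cases hjv : j ∈ v
        · simpa [l, hjv] using h1 j hjv
        by_cases hju : j ∈ u
        · simpa [l, hjv, hju] using h2 j (Finset.mem_sdiff.2 ⟨hju, hjv⟩)
        · have h0 : ∀ i, ⌊S i j⌋ = 0 := fun i => Int.floor_eq_zero_iff.2 (hS.1 i j)
          simp [l, hjv, hju, h0]
    rw [Finset.prod_mul_distrib, Finset.prod_neg, Finset.prod_boole, Finset.prod_boole]
    simp only [hiff, ite_and]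
    split_ifs <;> simp
  simp_rw [hterm, ← Finset.mul_sum, ← hcount]
  push_cast
  field_simp

/-- `q χ(⌊q ^ (k + 1) x⌋ = ⌊q ^ (k + 1) y⌋) - χ(⌊q ^ k x⌋ = ⌊q ^ k y⌋)` is a positive
semidefinite kernel on `[0, 1)`: it is a finite sum of products `φ x * φ y`. -/
lemma digit_kernel_eq_sum {q : ℕ} (hq : 1 ≤ q) (k : ℕ) :
    ∃ (A : Finset (ℤ × ℤ)) (φ : ℤ × ℤ → ℝ → ℝ),
      ∀ x ∈ Set.Ico (0 : ℝ) 1, ∀ y ∈ Set.Ico (0 : ℝ) 1,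
        (q : ℝ) * (if ⌊(q : ℝ) ^ (k + 1) * x⌋ = ⌊(q : ℝ) ^ (k + 1) * y⌋ then 1 else 0) -
            (if ⌊(q : ℝ) ^ k * x⌋ = ⌊(q : ℝ) ^ k * y⌋ then 1 else 0) =
          ∑ a ∈ A, φ a x * φ a y := by
  have hq0 : (0 : ℝ) < q := by exact_mod_cast hq
  let P : ℝ → ℤ := fun x => ⌊(q : ℝ) ^ k * x⌋
  let D : ℝ → ℤ := fun x => ⌊(q : ℝ) ^ (k + 1) * x⌋ % q
  have hP : ∀ x, P x = ⌊(q : ℝ) ^ (k + 1) * x⌋ / q := by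
    intro x
    rw [← Int.floor_div_natCast]
    rw [pow_succ, mul_right_comm, mul_div_cancel_right₀ _ hq0.ne']
  have hPD : ∀ x, ⌊(q : ℝ) ^ (k + 1) * x⌋ = q * P x + D x := fun x => by
    rw [hP, Int.mul_ediv_add_emod]
  have hPmem : ∀ x ∈ Set.Ico (0 : ℝ) 1, P x ∈ Finset.Ico 0 ((q : ℤ) ^ k) := by
    rintro x ⟨h0, h1⟩
    have hpos : (0 : ℝ) < (q : ℝ) ^ k := by positivity
    refine Finset.mem_Ico.2 ⟨Int.floor_nonneg.2 (by positivity), Int.floor_lt.2 ?_⟩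
    push_cast
    nlinarith
  have hDmem : ∀ x, D x ∈ Finset.Ico 0 (q : ℤ) := fun x =>
    Finset.mem_Ico.2 ⟨Int.emod_nonneg _ (by omega), Int.emod_lt_of_pos _ (by omega)⟩
  refine ⟨Finset.Ico 0 ((q : ℤ) ^ k) ×ˢ Finset.Ico 0 (q : ℤ), fun a x =>
    √q * ((if P x = a.1 then 1 else 0) * ((if D x = a.2 then 1 else 0) - (q : ℝ)⁻¹)), ?_⟩
  intro x hx y hy
  have hiff : ⌊(q : ℝ) ^ (k + 1) * x⌋ = ⌊(q : ℝ) ^ (k + 1) * y⌋ ↔ P x = P y ∧ D x = D y :=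
    ⟨fun h => ⟨by rw [hP, hP, h], by simp only [D, h]⟩, fun h => by rw [hPD, hPD, h.1, h.2]⟩
  have hcell : ∑ c ∈ Finset.Ico 0 ((q : ℤ) ^ k),
      (if P x = c then (1 : ℝ) else 0) * (if P y = c then 1 else 0) =
        if P x = P y then 1 else 0 := by
    simp only [ite_mul, one_mul, zero_mul, Finset.sum_ite_eq, hPmem x hx, if_true]
    simp only [eq_comm]
  have hdigit : ∑ s ∈ Finset.Ico 0 (q : ℤ),
      ((if D x = s then (1 : ℝ) else 0) - (q : ℝ)⁻¹) * ((if D y = s then 1 else 0) - (q : ℝ)⁻¹) =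
        (if D x = D y then 1 else 0) - (q : ℝ)⁻¹ := by
    simp only [sub_mul, mul_sub, Finset.sum_sub_distrib, ite_mul, mul_ite, one_mul, zero_mul,
      mul_one, mul_zero, Finset.sum_ite_eq, hDmem, if_true, Finset.sum_const, Int.card_Ico,
      sub_zero, Int.toNat_natCast, nsmul_eq_mul]
    rw [mul_inv_cancel_left₀ hq0.ne', sub_self, sub_zero]
  have hsplit : ∀ a : ℤ × ℤ,
      √(q : ℝ) * ((if P x = a.1 then 1 else 0) * ((if D x = a.2 then 1 else 0) - (q : ℝ)⁻¹)) *
        (√(q : ℝ) * ((if P y = a.1 then 1 else 0) * ((if D y = a.2 then 1 else 0) - (q : ℝ)⁻¹))) =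
      q * (((if P x = a.1 then 1 else 0) * (if P y = a.1 then 1 else 0)) *
        (((if D x = a.2 then 1 else 0) - (q : ℝ)⁻¹) *
          ((if D y = a.2 then 1 else 0) - (q : ℝ)⁻¹))) := fun a => by
    linear_combination ((if P x = a.1 then (1 : ℝ) else 0) * (if P y = a.1 then 1 else 0)) *
        (((if D x = a.2 then 1 else 0) - (q : ℝ)⁻¹) *
          ((if D y = a.2 then 1 else 0) - (q : ℝ)⁻¹)) * Real.mul_self_sqrt hq0.le
  simp only [hsplit]
  trans (q : ℝ) * ((if P x = P y then 1 else 0) * ((if D x = D y then 1 else 0) - (q : ℝ)⁻¹))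
  · simp only [hiff, ite_and]
    change _ - (if P x = P y then (1 : ℝ) else 0) = _
    split_ifs <;> field_simp <;> simp
  · rw [← hcell, ← hdigit, Finset.sum_mul_sum, ← Finset.mul_sum, Finset.sum_product]

lemma gain_nonneg {d : ℕ} {q : Fin d → ℕ} {S : ℕ → Fin d → ℝ}
    (hq : ∀ j, 1 ≤ q j) (hS : ∀ i j, S i j ∈ Set.Ico (0 : ℝ) 1) (u : Finset (Fin d))
    (k : Fin d → ℕ) (n : ℕ) : 0 ≤ gain q S u k n := by
  choose A φ hφ using fun j => digit_kernel_eq_sum (hq j) (k j)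
  unfold gain
  refine mul_nonneg (mul_nonneg (Finset.prod_nonneg fun j _ => ?_) (by positivity)) ?_
  · have : (1 : ℝ) ≤ q j := by exact_mod_cast hq j
    exact inv_nonneg.2 (by linarith)
  · have h : ∀ i i', ∏ j ∈ u, ((q j : ℝ) *
          (if ⌊(q j : ℝ) ^ (k j + 1) * S i j⌋ = ⌊(q j : ℝ) ^ (k j + 1) * S i' j⌋
            then 1 else 0) -
          (if ⌊(q j : ℝ) ^ k j * S i j⌋ = ⌊(q j : ℝ) ^ k j * S i' j⌋ then 1 else 0)) =
        ∑ p ∈ u.pi A,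
          (∏ j ∈ u.attach, φ j (p j j.2) (S i j)) * ∏ j ∈ u.attach, φ j (p j j.2) (S i' j) := by
      intro i i'
      rw [Finset.prod_congr rfl fun j _ => hφ j _ (hS i j) _ (hS i' j), Finset.prod_sum]
      simp_rw [Finset.prod_mul_distrib]
    simp_rw [h]
    rw [Finset.sum_congr rfl fun i _ => Finset.sum_comm, Finset.sum_comm]
    refine Finset.sum_nonneg fun p _ => ?_
    rw [← Finset.sum_mul_sum]
    exact mul_self_nonneg _

lemma IsEquidistributed.altSum_residueForm_nonneg {d : ℕ} {q : Fin d → ℕ} {S : ℕ → Fin d → ℝ}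
    (hq : ∀ j, 2 ≤ q j) (hS : IsEquidistributed q S) {u : Finset (Fin d)} (hu : u.Nonempty)
    (n : ℕ) : 0 ≤ altSum q (residueForm n) u 1 := by
  have hq1 : ∀ j, 1 ≤ q j := fun j => le_trans one_le_two (hq j)
  rcases Nat.eq_zero_or_pos n with rfl | hn
  · simp [altSum, residueForm]
  have h := gain_nonneg hq1 hS.1 u (fun _ => 0) n
  rw [hS.gain_eq hq1 hu] at h
  simp only [pow_zero, Finset.prod_const_one, Nat.cast_one, inv_one, one_mul] at h
  refine nonneg_of_mul_nonneg_right h (mul_pos (Finset.prod_pos fun j _ => ?_) (by positivity))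
  have : (2 : ℝ) ≤ q j := by exact_mod_cast hq j
  exact inv_pos.2 (by linarith)

lemma altSum_residueForm_eq {d : ℕ} {b : ℕ} (hb : 2 ≤ b) {e : Fin d → ℕ} (he : ∀ j, 1 ≤ e j)
    {u : Finset (Fin d)} {a : Fin d} (ha : a ∈ u) (hmin : ∀ j ∈ u, e a ≤ e j) {M : ℕ}
    (hM : 1 ≤ M) :
    altSum (fun j => b ^ e j) (residueForm (M * ∏ j ∈ u.erase a, b ^ e j)) u M =
      ((M * ∏ j ∈ u.erase a, b ^ e j : ℕ) : ℝ) * (((b ^ e a : ℕ) : ℝ) - 1) *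
        ((M * ∏ j ∈ u.erase a, b ^ e j : ℕ) : ℝ) := by
  unfold altSum
  rw [Finset.sum_eq_single_of_mem u (Finset.mem_powerset_self u)]
  · have h1 : M * ∏ j ∈ u, b ^ e j = (M * ∏ j ∈ u.erase a, b ^ e j) * b ^ e a := by
      rw [mul_assoc, Finset.prod_erase_mul _ _ ha]
    have hpos : 0 < M * ∏ j ∈ u.erase a, b ^ e j :=
      Nat.mul_pos hM (Finset.prod_pos fun j _ => by positivity)
    have hba : 1 < b ^ e a := Nat.one_lt_pow (by have := he a; omega) (by omega)
    rw [h1]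
    unfold residueForm
    rw [Nat.mod_eq_of_lt (lt_mul_of_one_lt_right hpos hba)]
    simp only [sdiff_self, Finset.bot_eq_empty, Finset.card_empty, pow_zero]
    push_cast
    ring
  · intro v hv hvu
    rw [Finset.mem_powerset] at hv
    obtain ⟨c, hcu, hcv⟩ := Finset.exists_of_ssubset (hv.ssubset_of_ne hvu)
    have hle : ∑ j ∈ v, e j ≤ ∑ j ∈ u.erase a, e j := by
      have h1 : ∑ j ∈ v, e j ≤ ∑ j ∈ u.erase c, e j :=
        Finset.sum_le_sum_of_subset (Finset.subset_erase.2 ⟨hv, hcv⟩)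
      have h2 := Finset.sum_erase_add u e hcu
      have h3 := Finset.sum_erase_add u e ha
      have h4 := hmin c hcu
      omega
    have hdvd : M * ∏ j ∈ v, b ^ e j ∣ M * ∏ j ∈ u.erase a, b ^ e j := by
      rw [Finset.prod_pow_eq_pow_sum, Finset.prod_pow_eq_pow_sum]
      exact mul_dvd_mul_left _ (pow_dvd_pow _ hle)
    simp [residueForm, Nat.mod_eq_zero_of_dvd hdvd]

theorem statement10 {d : ℕ} (hd : 1 ≤ d) (b : ℕ) (hb : 2 ≤ b)
    (e : Fin d → ℕ) (he : ∀ j, 1 ≤ e j)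
    (S : ℕ → Fin d → ℝ) (hS : IsEquidistributed (fun j => b ^ e j) S)
    (u : Finset (Fin d)) (hu : u.Nonempty)
    (jm : Fin d) (hjm : jm ∈ u) (hmin : ∀ j ∈ u, e jm ≤ e j)
    (k : Fin d → ℕ) :
    IsGreatest {x : ℝ | ∃ n : ℕ, 1 ≤ n ∧ x = gain (fun j => b ^ e j) S u k n}
      (∏ j ∈ u.erase jm, (b : ℝ) ^ e j / ((b : ℝ) ^ e j - 1)) := by
  have hq2 : ∀ j, 2 ≤ b ^ e j := fun j =>
    Nat.one_lt_pow (by have := he j; omega) (by omega)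
  have hq1 : ∀ j, 1 ≤ b ^ e j := fun j => le_trans one_le_two (hq2 j)
  have hM : 1 ≤ ∏ j ∈ u, (b ^ e j) ^ k j :=
    Finset.one_le_prod' fun j _ => Nat.one_le_pow _ _ (hq1 j)
  have hsub : ∀ j, (0 : ℝ) < (b : ℝ) ^ e j - 1 := fun j => by
    have : (2 : ℝ) ≤ (b : ℝ) ^ e j := by exact_mod_cast hq2 j
    linarith
  have hgain : ∀ n, gain (fun j => b ^ e j) S u k n = _ := hS.gain_eq hq1 hu k
  generalize ∏ j ∈ u, (b ^ e j) ^ k j = M at hM hgain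
  have hM0 : (0 : ℝ) < M := by exact_mod_cast hM
  have hΓ : ∀ n : ℕ, 1 ≤ n → ∏ j ∈ u.erase jm, (b : ℝ) ^ e j / ((b : ℝ) ^ e j - 1) =
      (∏ j ∈ u, (((b ^ e j : ℕ) : ℝ) - 1)⁻¹) * (n : ℝ)⁻¹ * ((M : ℝ)⁻¹ *
        (((M * ∏ j ∈ u.erase jm, b ^ e j : ℕ) : ℝ) * (((b ^ e jm : ℕ) : ℝ) - 1) * n)) := by
    intro n hn
    have hn0 : (0 : ℝ) < n := by exact_mod_cast hn
    have h0 := hsub jm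
    rw [← Finset.prod_erase_mul u _ hjm, Finset.prod_div_distrib, Finset.prod_inv_distrib]
    have hP : (0 : ℝ) < ∏ j ∈ u.erase jm, ((b : ℝ) ^ e j - 1) :=
      Finset.prod_pos fun j _ => hsub j
    push_cast
    field_simp
  constructor
  · have hn : 1 ≤ M * ∏ j ∈ u.erase jm, b ^ e j :=
      Nat.mul_pos hM (Finset.prod_pos fun j _ => hq1 j)
    refine ⟨M * ∏ j ∈ u.erase jm, b ^ e j, hn, ?_⟩
    rw [hgain, altSum_residueForm_eq hb he hjm hmin hM, hΓ _ hn]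
  · rintro x ⟨n, hn, rfl⟩
    rw [hgain, hΓ n hn]
    have key := altSum_residueForm_le (fun j => b ^ e j) hq1 jm n
      (fun w hw t => hS.altSum_residueForm_nonneg hq2 hw t) (u.erase jm)
      (Finset.notMem_erase jm u) M hM
    rw [Finset.insert_erase hjm] at key
    have hP : (0 : ℝ) ≤ ∏ j ∈ u, (((b ^ e j : ℕ) : ℝ) - 1)⁻¹ :=
      Finset.prod_nonneg fun j _ => inv_nonneg.2 (by push_cast; exact (hsub j).le)
    gcongr

end
end

section
/- Let b ≥ 2 be an integer, e_1,…,e_d ∈ ℕ, and let S be an equidistributed sequence in base (b^{e_1},…,b^{e_d}); write G_{u,k}(n) for the gain coefficient of its first n points in this base. Fix a nonempty u ⊆ {1,…,d}, let j_m ∈ u minimize e_j over j ∈ u, and set n* := ∏_{j∈u∖{j_m}} b^{e_j}. Then G_{u,0}(n*) = ∏_{j∈u∖{j_m}} b^{e_j}/(b^{e_j}−1), where 0 denotes the all-zero multi-index on u (and both sides equal 1 when u = {j_m}). -/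
open Finset MeasureTheory

noncomputable section


/-- In every block of `∏ j ∈ v, b j` consecutive points, exactly one agrees with a given point
in the leading base-`b` digit of each coordinate in `v`. -/
lemma IsEquidistributed.sum_Ico_agree {d : ℕ} {b : Fin d → ℕ} {S : ℕ → Fin d → ℝ}
    (hS : IsEquidistributed b S) (hb : ∀ j, 0 < b j) (v : Finset (Fin d)) (i r : ℕ) :
    ∑ i' ∈ Finset.Ico (r * ∏ j ∈ v, b j) ((r + 1) * ∏ j ∈ v, b j),
      (∏ j ∈ v, if ⌊(b j : ℝ) * S i j⌋ = ⌊(b j : ℝ) * S i' j⌋ then (1 : ℝ) else 0) = 1 := by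
  have hprod : ∏ j, b j ^ (if j ∈ v then 1 else 0) = ∏ j ∈ v, b j := by
    simp [pow_ite, Finset.prod_ite_mem]
  obtain ⟨t, ⟨htm, ht⟩, huniq⟩ := hS.2 r (fun j => if j ∈ v then 1 else 0)
    (fun j => if j ∈ v then ⌊(b j : ℝ) * S i j⌋ else 0) (by
      intro j
      by_cases hj : j ∈ v
      · have hpos : (0 : ℝ) < b j := by exact_mod_cast hb j
        simp only [hj, if_true, pow_one]
        refine ⟨Int.floor_nonneg.2 (mul_nonneg hpos.le (hS.1 i j).1), Int.floor_lt.2 ?_⟩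
        push_cast
        nlinarith [(hS.1 i j).2]
      · simp [hj])
  simp only [hprod] at htm huniq
  rw [Finset.sum_eq_single_of_mem t htm]
  · refine Finset.prod_eq_one fun j hj => if_pos ?_
    simpa [hj] using (ht j).symm
  · intro i' hi' hne
    by_contra hcon
    refine hne (huniq i' ⟨hi', fun j => ?_⟩)
    by_cases hj : j ∈ v
    · have hagree := Finset.prod_ne_zero_iff.1 hcon j hj
      simpa [hj] using (ite_ne_right_iff.1 hagree).1.symm
    · have hmem := hS.1 i' j
      simpa [hj, Int.floor_eq_zero_iff] using hmem

/-- If `∏ j ∈ v, b j` divides `n`, then the first `n` points are split evenly among the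
elementary intervals of resolution one in the coordinates of `v`. -/
lemma IsEquidistributed.prod_mul_sum_range_agree {d : ℕ} {b : Fin d → ℕ} {S : ℕ → Fin d → ℝ}
    (hS : IsEquidistributed b S) (hb : ∀ j, 0 < b j) (v : Finset (Fin d)) (i : ℕ) {n : ℕ}
    (hn : ∏ j ∈ v, b j ∣ n) :
    (∏ j ∈ v, (b j : ℝ)) * ∑ i' ∈ Finset.range n,
      (∏ j ∈ v, if ⌊(b j : ℝ) * S i j⌋ = ⌊(b j : ℝ) * S i' j⌋ then (1 : ℝ) else 0) = n := by
  obtain ⟨q, rfl⟩ := hn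
  rw [mul_comm (∏ j ∈ v, b j) q]
  push_cast
  rw [mul_comm (q : ℝ)]
  congr 1
  induction q with
  | zero => simp
  | succ q ih =>
    rw [← Finset.sum_range_add_sum_Ico _ (Nat.mul_le_mul_right _ q.le_succ), ih,
      hS.sum_Ico_agree hb v i q]
    push_cast
    ring

/-- Among the first `∏ j ∈ w, b j` points, a point agrees only with itself in the leading digits
of a set of coordinates containing `w`. -/
lemma IsEquidistributed.sum_range_agree_eq_one {d : ℕ} {b : Fin d → ℕ} {S : ℕ → Fin d → ℝ}
    (hS : IsEquidistributed b S) (hb : ∀ j, 0 < b j) {w u : Finset (Fin d)} (hwu : w ⊆ u)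
    {i : ℕ} (hi : i < ∏ j ∈ w, b j) :
    ∑ i' ∈ Finset.range (∏ j ∈ w, b j),
      (∏ j ∈ u, if ⌊(b j : ℝ) * S i j⌋ = ⌊(b j : ℝ) * S i' j⌋ then (1 : ℝ) else 0) = 1 := by
  have hnonneg : ∀ s : Finset (Fin d), ∀ i', 0 ≤ ∏ j ∈ s,
      if ⌊(b j : ℝ) * S i j⌋ = ⌊(b j : ℝ) * S i' j⌋ then (1 : ℝ) else 0 := fun s i' =>
    Finset.prod_nonneg fun j _ => by split_ifs <;> norm_num
  apply le_antisymm
  · have h := hS.sum_Ico_agree hb w i 0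
    simp only [zero_mul, zero_add, one_mul, ← Finset.range_eq_Ico] at h
    refine (Finset.sum_le_sum fun i' _ => ?_).trans_eq h
    rw [← Finset.prod_sdiff hwu]
    refine mul_le_of_le_one_left (hnonneg w i') (Finset.prod_le_one ?_ ?_) <;>
      · intro j _
        split_ifs <;> norm_num
  · refine le_trans ?_ (Finset.single_le_sum (fun i' _ => hnonneg u i') (Finset.mem_range.2 hi))
    simp

theorem statement11 {d : ℕ} (hd : 1 ≤ d) (b : ℕ) (hb : 2 ≤ b)
    (e : Fin d → ℕ) (he : ∀ j, 1 ≤ e j)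
    (S : ℕ → Fin d → ℝ) (hS : IsEquidistributed (fun j => b ^ e j) S)
    (u : Finset (Fin d)) (hu : u.Nonempty)
    (jm : Fin d) (hjm : jm ∈ u) (hmin : ∀ j ∈ u, e jm ≤ e j) :
    gain (fun j => b ^ e j) S u (fun _ => 0) (∏ j ∈ u.erase jm, b ^ e j) =
      ∏ j ∈ u.erase jm, (b : ℝ) ^ e j / ((b : ℝ) ^ e j - 1) := by
  set B : Fin d → ℕ := fun j => b ^ e j with hB
  have hB2 : ∀ j, 2 ≤ B j := fun j =>
    hb.trans (Nat.le_self_pow (Nat.one_le_iff_ne_zero.1 (he j)) b)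
  have hBpos : ∀ j, 0 < B j := fun j => two_pos.trans_le (hB2 j)
  have hB1 : ∀ j, (B j : ℝ) - 1 ≠ 0 := fun j => by
    have : (2 : ℝ) ≤ B j := by exact_mod_cast hB2 j
    linarith
  set n : ℕ := ∏ j ∈ u.erase jm, B j with hn
  have hn0 : (n : ℝ) ≠ 0 := by
    exact_mod_cast (Finset.prod_pos fun j _ => hBpos j).ne'
  have hdvd : ∀ v ⊆ u, v ≠ u → ∏ j ∈ v, B j ∣ n := by
    intro v hv hne
    by_cases hm : jm ∈ v
    · obtain ⟨l, hlu, hlv⟩ := Finset.exists_of_ssubset (hv.ssubset_of_ne hne)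
      have hl : l ∈ u.erase jm := Finset.mem_erase.2 ⟨fun h => hlv (h ▸ hm), hlu⟩
      rw [hn, ← Finset.mul_prod_erase v B hm, ← Finset.mul_prod_erase _ B hl]
      refine mul_dvd_mul (pow_dvd_pow b (hmin l hlu)) (Finset.prod_dvd_prod_of_subset _ _ _ ?_)
      intro j hj
      obtain ⟨hjm', hjv⟩ := Finset.mem_erase.1 hj
      exact Finset.mem_erase.2 ⟨fun h => hlv (h ▸ hjv), Finset.mem_erase.2 ⟨hjm', hv hjv⟩⟩
    · refine Finset.prod_dvd_prod_of_subset _ _ _ fun j hj => ?_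
      exact Finset.mem_erase.2 ⟨fun h => hm (h ▸ hj), hv hj⟩
  have hprodu : ∏ j ∈ u, (B j : ℝ) = B jm * n := by
    rw [hn, ← Finset.mul_prod_erase u _ hjm, Nat.cast_prod]
  have hinner : ∀ i ∈ Finset.range n, ∑ i' ∈ Finset.range n, ∏ j ∈ u,
      ((B j : ℝ) * (if ⌊(B j : ℝ) * S i j⌋ = ⌊(B j : ℝ) * S i' j⌋ then 1 else 0) + -1) =
        n * ((B jm : ℝ) - 1) := by
    intro i hi
    have hterm : ∀ v ∈ u.powerset, ∑ i' ∈ Finset.range n, ((∏ j ∈ v,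
        ((B j : ℝ) * (if ⌊(B j : ℝ) * S i j⌋ = ⌊(B j : ℝ) * S i' j⌋ then 1 else 0))) *
          ∏ j ∈ u \ v, (-1 : ℝ)) =
        n * ((∏ j ∈ v, (1 : ℝ)) * ∏ j ∈ u \ v, (-1 : ℝ)) +
          if v = u then n * ((B jm : ℝ) - 1) else 0 := by
      intro v hv
      simp only [Finset.prod_mul_distrib]
      rw [← Finset.sum_mul, ← Finset.mul_sum]
      split_ifs with hvu
      · subst hvu
        rw [hS.sum_range_agree_eq_one hBpos (Finset.erase_subset jm v) (Finset.mem_range.1 hi),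
          hprodu]
        simp
        ring
      · rw [hS.prod_mul_sum_range_agree hBpos v i (hdvd v (Finset.mem_powerset.1 hv) hvu)]
        simp
    simp only [Finset.prod_add]
    rw [Finset.sum_comm, Finset.sum_congr rfl hterm, Finset.sum_add_distrib, ← Finset.mul_sum,
      ← Finset.prod_add]
    simp [hu.ne_empty]
  have hsum := Finset.sum_congr rfl hinner
  simp only [Finset.sum_const, Finset.card_range, nsmul_eq_mul] at hsum
  have hR : ∏ j ∈ u.erase jm, (b : ℝ) ^ e j / ((b : ℝ) ^ e j - 1) =
      n * ∏ j ∈ u.erase jm, ((B j : ℝ) - 1)⁻¹ := by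
    simp only [hn, hB, Nat.cast_prod, Nat.cast_pow, div_eq_mul_inv, Finset.prod_mul_distrib]
  have hfloor : ∀ i j, ⌊S i j⌋ = 0 := fun i j => Int.floor_eq_zero_iff.2 (hS.1 i j)
  rw [hR]
  unfold gain
  simp only [zero_add, pow_one, pow_zero, one_mul, hfloor, if_true, sub_eq_add_neg _ (1 : ℝ)]
  rw [hsum, ← Finset.mul_prod_erase u _ hjm]
  have := hB1 jm
  simp only [← sub_eq_add_neg]
  field_simp

end
end

section
/- Let q be a prime power, F_q the finite field with q elements, and for n ∈ ℕ let I(n) denote the number of monic irreducible polynomials of degree n in F_q[X]. Then for every integer M ≥ 1, ∏_{n=1}^{M} ( q^n/(q^n−1) )^{I(n) − χ(n=1)} ≤ e·M, where χ(n=1) equals 1 if n = 1 and 0 otherwise, and e is Euler's number. Equivalently, Σ_{n=1}^{M} (I(n) − χ(n=1)) · ln(1 + 1/(q^n−1)) ≤ 1 + ln M. -/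
open Finset Polynomial

noncomputable section

/-- The number of monic irreducible polynomials of degree `n` over the finite field `F`. -/
def numMonicIrreducible (F : Type*) [Field F] [Fintype F] (n : ℕ) : ℕ :=
  Nat.card {p : Polynomial F // p.Monic ∧ Irreducible p ∧ p.natDegree = n}

/-- Distinct monic irreducible polynomials are coprime, so a product of those whose degree divides
`n` divides `X ^ q ^ n - X`, and the total degree is at most `q ^ n`. -/
theorem sum_natDegree_le_card_pow {F : Type*} [Field F] [Fintype F] {n : ℕ} (hn : n ≠ 0)
    (T : Finset F[X]) (hT : ∀ p ∈ T, p.Monic ∧ Irreducible p ∧ p.natDegree ∣ n) :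
    ∑ p ∈ T, p.natDegree ≤ Fintype.card F ^ n := by
  have hq : 1 < Fintype.card F := Fintype.one_lt_card
  have hdvd : ∏ p ∈ T, p ∣ (X ^ Fintype.card F ^ n - X : F[X]) := by
    refine Finset.prod_dvd_of_coprime (fun p hp r hr hpr => ?_) fun p hp => ?_
    · obtain ⟨hpm, hpi, -⟩ := hT p hp
      obtain ⟨hrm, hri, -⟩ := hT r hr
      exact hpi.coprime_iff_not_dvd.2 fun h =>
        hpr (eq_of_monic_of_associated hpm hrm (hpi.associated_of_dvd hri h))
    · obtain ⟨-, hpi, hpn⟩ := hT p hp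
      rw [← Nat.card_eq_fintype_card]
      exact hpi.natDegree_dvd_iff_dvd_X_pow_card_pow_sub_X.1 hpn
  have hdeg := natDegree_le_of_dvd hdvd (FiniteField.X_pow_card_pow_sub_X_ne_zero F hn hq)
  rwa [FiniteField.X_pow_card_pow_sub_X_natDegree_eq F hn hq,
    natDegree_prod_of_monic _ _ fun p hp => (hT p hp).1] at hdeg

/-- The polynomial `X` accounts for one unit of degree in `X ^ q ^ n - X`. -/
theorem mul_numMonicIrreducible_sub_add_one_le (F : Type*) [Field F] [Fintype F] {n : ℕ}
    (hn : n ≠ 0) :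
    n * (numMonicIrreducible F n - if n = 1 then 1 else 0) + 1 ≤ Fintype.card F ^ n := by
  classical
  set S : Set F[X] := {p | p.Monic ∧ Irreducible p ∧ p.natDegree = n} with hS
  have hI : numMonicIrreducible F n = S.ncard := rfl
  by_cases hfin : S.Finite
  · set T := hfin.toFinset
    have hmem : ∀ p, p ∈ T ↔ p.Monic ∧ Irreducible p ∧ p.natDegree = n := by simp [T, hS]
    have hcard : numMonicIrreducible F n - (if n = 1 then 1 else 0) ≤ (T.erase X).card := by
      rw [hI, Set.ncard_eq_toFinset_card S hfin]
      split_ifs with h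
      · exact Finset.pred_card_le_card_erase
      · have hX : (X : F[X]) ∉ T := fun hX => h (by simpa using ((hmem X).1 hX).2.2.symm)
        rw [Finset.erase_eq_of_notMem hX, Nat.sub_zero]
    have hdeg := sum_natDegree_le_card_pow hn (insert X (T.erase X)) fun p hp => by
      rcases Finset.mem_insert.1 hp with rfl | hp
      · exact ⟨monic_X, irreducible_X, by simp⟩
      · obtain ⟨hm, hi, hd⟩ := (hmem p).1 (Finset.mem_of_mem_erase hp)
        exact ⟨hm, hi, hd.dvd⟩
    rw [Finset.sum_insert (Finset.notMem_erase X T), natDegree_X,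
      Finset.sum_const_nat fun p hp => ((hmem p).1 (Finset.mem_of_mem_erase hp)).2.2] at hdeg
    calc _ ≤ n * (T.erase X).card + 1 := by gcongr
      _ ≤ _ := by linarith
  · rw [hI, Set.Infinite.ncard hfin, Nat.zero_sub, mul_zero, zero_add]
    exact Nat.one_le_pow _ _ Fintype.card_pos

theorem sum_mul_log_le_one_add_log (F : Type*) [Field F] [Fintype F] (M : ℕ) :
    (∑ n ∈ Finset.Icc 1 M,
        ((numMonicIrreducible F n - if n = 1 then 1 else 0 : ℕ) : ℝ) *
          Real.log (1 + 1 / ((Fintype.card F : ℝ) ^ n - 1))) ≤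
      1 + Real.log M := by
  have hharm := harmonic_le_one_add_log M
  rw [harmonic_eq_sum_Icc] at hharm
  push_cast at hharm
  refine (Finset.sum_le_sum fun n hn => ?_).trans hharm
  have hn : 1 ≤ n := (Finset.mem_Icc.1 hn).1
  have hq : (1 : ℝ) < (Fintype.card F : ℝ) ^ n :=
    one_lt_pow₀ (mod_cast Fintype.one_lt_card) (by omega)
  have hpos : 0 < (Fintype.card F : ℝ) ^ n - 1 := by linarith
  have hcount : (n : ℝ) * ((numMonicIrreducible F n - if n = 1 then 1 else 0 : ℕ) : ℝ) + 1 ≤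
      (Fintype.card F : ℝ) ^ n := by
    exact_mod_cast mul_numMonicIrreducible_sub_add_one_le F (by omega : n ≠ 0)
  have hlog := Real.log_le_sub_one_of_pos
    (show 0 < 1 + 1 / ((Fintype.card F : ℝ) ^ n - 1) by positivity)
  rw [add_sub_cancel_left] at hlog
  refine (mul_le_mul_of_nonneg_left hlog (Nat.cast_nonneg _)).trans ?_
  have hn0 : (0 : ℝ) < n := by exact_mod_cast hn
  rw [mul_one_div, inv_eq_one_div, div_le_div_iff₀ hpos hn0]
  linarith

theorem statement12 (F : Type*) [Field F] [Fintype F] (M : ℕ) (hM : 1 ≤ M) :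
    (∏ n ∈ Finset.Icc 1 M,
        ((Fintype.card F : ℝ) ^ n / ((Fintype.card F : ℝ) ^ n - 1)) ^
          (numMonicIrreducible F n - if n = 1 then 1 else 0)) ≤
      Real.exp 1 * M ∧
    (∑ n ∈ Finset.Icc 1 M,
        ((numMonicIrreducible F n - if n = 1 then 1 else 0 : ℕ) : ℝ) *
          Real.log (1 + 1 / ((Fintype.card F : ℝ) ^ n - 1))) ≤
      1 + Real.log M := by
  refine ⟨?_, sum_mul_log_le_one_add_log F M⟩
  have hM0 : (0 : ℝ) < M := by exact_mod_cast hM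
  have hexp := Real.exp_le_exp.2 (sum_mul_log_le_one_add_log F M)
  rw [Real.exp_add, Real.exp_log hM0, Real.exp_sum] at hexp
  refine le_of_eq_of_le (Finset.prod_congr rfl fun n hn => ?_) hexp
  have hn : 1 ≤ n := (Finset.mem_Icc.1 hn).1
  have hq : (1 : ℝ) < (Fintype.card F : ℝ) ^ n :=
    one_lt_pow₀ (mod_cast Fintype.one_lt_card) (by omega)
  have hpos : 0 < (Fintype.card F : ℝ) ^ n - 1 := by linarith
  rw [Real.exp_nat_mul, Real.exp_log (by positivity)]
  congr 1
  field_simp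
  ring

end
end
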